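/- arXiv:1301.2446 — 8 statements merged into one kernel-verified Lean document; each statement's English description precedes it below -/
import Mathlib

section
/- Let A be a finite-dimensional (right) H-comodule algebra over a field F, where H is a Hopf algebra over F whose antipode S is bijective. If I is a two-sided ideal of A, then the subspace H*·I := span_F { h*·a : h* ∈ H*, a ∈ I } is also a two-sided ideal of A. -/
open TensorProduct

/-- The action of a linear functional `f : H →ₗ[F] F` on an element of a (right) `H`-comodule
with structure map `ρ`, given by `f · a = (id_A ⊗ f)(ρ a)` under `A ⊗[F] F ≅ A`. -/
noncomputable def coactF {F : Type*} [Field F] {A H : Type*}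
    [AddCommGroup A] [Module F A] [AddCommGroup H] [Module F H]
    (ρ : A →ₗ[F] A ⊗[F] H) (f : H →ₗ[F] F) (a : A) : A :=
  TensorProduct.rid F A (LinearMap.lTensor A f (ρ a))

open Coalgebra HopfAlgebra

section

variable {F : Type*} [Field F] {H : Type*} [Ring H] [HopfAlgebra F H] {A : Type*} [Ring A]
  [Algebra F A]

/-- If `ψ` is a left inverse of the comultiplication in the sense that `ψ (Δ h) = ε(h) 1`, then
`∑ b₀ ⊗ ψ (b₁ ⊗ b₂) = b ⊗ 1` in any right comodule. -/
lemma lTensor_assoc_rTensor_coaction (ρ : A →ₐ[F] A ⊗[F] H)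
    (hcoassoc : ∀ a : A, (TensorProduct.assoc F A H H)
        ((LinearMap.rTensor H ρ.toLinearMap) (ρ a))
      = (LinearMap.lTensor A (comul (R := F) (A := H))) (ρ a))
    (hcounit : ∀ a : A, (TensorProduct.rid F A)
        ((LinearMap.lTensor A (counit (R := F) (A := H))) (ρ a)) = a)
    (ψ : H ⊗[F] H →ₗ[F] H) (hψ : ψ ∘ₗ comul = Algebra.linearMap F H ∘ₗ counit) (b : A) :
    LinearMap.lTensor A ψ (TensorProduct.assoc F A H H
      (LinearMap.rTensor H ρ.toLinearMap (ρ b))) = b ⊗ₜ 1 := by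
  have key (u : A ⊗[F] F) : LinearMap.lTensor A (Algebra.linearMap F H) u =
      TensorProduct.rid F A u ⊗ₜ 1 := by
    induction u with
    | zero => simp
    | add x y hx hy => simp [hx, hy, TensorProduct.add_tmul]
    | tmul a c => simp [Algebra.algebraMap_eq_smul_one, TensorProduct.smul_tmul]
  rw [hcoassoc, ← LinearMap.comp_apply, ← LinearMap.lTensor_comp, hψ, LinearMap.lTensor_comp,
    LinearMap.comp_apply, key, hcounit]

lemma lTensor_mul_lTensor_assoc_tmul (g : H →ₗ[F] H) (v : A ⊗[F] H) (h : H) :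
    LinearMap.lTensor A (LinearMap.mul' F H ∘ₗ LinearMap.lTensor H g)
      (TensorProduct.assoc F A H H (v ⊗ₜ h)) = v * (1 ⊗ₜ g h) := by
  induction v with
  | zero => simp
  | add x y hx hy => simp only [TensorProduct.add_tmul, map_add, hx, hy, add_mul]
  | tmul a k => simp

lemma lTensor_mul_rTensor_comm_assoc_tmul (g : H →ₗ[F] H) (v : A ⊗[F] H) (h : H) :
    LinearMap.lTensor A (LinearMap.mul' F H ∘ₗ LinearMap.rTensor H g ∘ₗ
      (TensorProduct.comm F H H).toLinearMap)
      (TensorProduct.assoc F A H H (v ⊗ₜ h)) = (1 ⊗ₜ g h) * v := by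
  induction v with
  | zero => simp
  | add x y hx hy => simp only [TensorProduct.add_tmul, map_add, hx, hy, mul_add]
  | tmul a k => simp

lemma rid_lTensor_mul_one_tmul (f : H →ₗ[F] F) (v : A ⊗[F] H) (k : H) :
    TensorProduct.rid F A (LinearMap.lTensor A f (v * (1 ⊗ₜ k))) =
      TensorProduct.rid F A (LinearMap.lTensor A (f ∘ₗ LinearMap.mulRight F k) v) := by
  induction v with
  | zero => simp
  | add x y hx hy => simp only [add_mul, map_add, hx, hy]
  | tmul a l => simp

lemma rid_lTensor_one_tmul_mul (f : H →ₗ[F] F) (v : A ⊗[F] H) (k : H) :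
    TensorProduct.rid F A (LinearMap.lTensor A f ((1 ⊗ₜ k) * v)) =
      TensorProduct.rid F A (LinearMap.lTensor A (f ∘ₗ LinearMap.mulLeft F k) v) := by
  induction v with
  | zero => simp
  | add x y hx hy => simp only [mul_add, map_add, hx, hy]
  | tmul a l => simp

lemma rid_lTensor_mul_tmul_one (f : H →ₗ[F] F) (v : A ⊗[F] H) (b : A) :
    TensorProduct.rid F A (LinearMap.lTensor A f (v * (b ⊗ₜ 1))) =
      TensorProduct.rid F A (LinearMap.lTensor A f v) * b := by
  induction v with
  | zero => simp
  | add x y hx hy => simp only [add_mul, map_add, hx, hy]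
  | tmul a l => simp

lemma rid_lTensor_tmul_one_mul (f : H →ₗ[F] F) (v : A ⊗[F] H) (b : A) :
    TensorProduct.rid F A (LinearMap.lTensor A f ((b ⊗ₜ 1) * v)) =
      b * TensorProduct.rid F A (LinearMap.lTensor A f v) := by
  induction v with
  | zero => simp
  | add x y hx hy => simp only [mul_add, map_add, hx, hy]
  | tmul a l => simp

/-- A right inverse `T` of the antipode satisfies `∑ T(h₂) h₁ = ε(h) 1`, provided the antipode is
injective. -/
lemma mul_rTensor_comm_comul_of_antipode_comp_eq_id
    (hS : Function.Injective (antipode F (A := H))) (T : H →ₗ[F] H)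
    (hT : antipode F ∘ₗ T = LinearMap.id) :
    (LinearMap.mul' F H ∘ₗ LinearMap.rTensor H T ∘ₗ (TensorProduct.comm F H H).toLinearMap) ∘ₗ
      comul = Algebra.linearMap F H ∘ₗ counit := by
  have key : antipode F ∘ₗ (LinearMap.mul' F H ∘ₗ LinearMap.rTensor H T ∘ₗ
      (TensorProduct.comm F H H).toLinearMap) =
      LinearMap.mul' F H ∘ₗ LinearMap.rTensor H (antipode F) := by
    ext a b
    simpa [antipode_mul_antidistrib] using congr(antipode F a * $hT b)
  ext h
  apply hS
  have h2 := congr($key (comul h))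
  simp only [LinearMap.comp_apply, mul_antipode_rTensor_comul_apply] at h2 ⊢
  rw [h2]
  simp [Algebra.algebraMap_eq_smul_one]

end

/-- if `I` is a two-sided ideal of a finite-dimensional `H`-comodule algebra `A`
(`H` a Hopf algebra with bijective antipode), then `H^* · I` is a two-sided ideal of `A`. -/
theorem stmt1 {F : Type*} [Field F] {H : Type*} [Ring H] [HopfAlgebra F H]
    {A : Type*} [Ring A] [Algebra F A] [FiniteDimensional F A]
    (ρ : A →ₐ[F] A ⊗[F] H)
    (hcoassoc : ∀ a : A, (TensorProduct.assoc F A H H)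
        ((LinearMap.rTensor H ρ.toLinearMap) (ρ a))
      = (LinearMap.lTensor A (Coalgebra.comul (R := F) (A := H))) (ρ a))
    (hcounit : ∀ a : A, (TensorProduct.rid F A)
        ((LinearMap.lTensor A (Coalgebra.counit (R := F) (A := H))) (ρ a)) = a)
    (hS : Function.Bijective (HopfAlgebra.antipode (R := F) (A := H)))
    (I : TwoSidedIdeal A) :
    ∀ x ∈ Submodule.span F
        {x : A | ∃ (f : H →ₗ[F] F) (a : A), a ∈ I ∧ x = coactF ρ.toLinearMap f a},
      ∀ b : A,
        x * b ∈ Submodule.span F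
          {x : A | ∃ (f : H →ₗ[F] F) (a : A), a ∈ I ∧ x = coactF ρ.toLinearMap f a} ∧
        b * x ∈ Submodule.span F
          {x : A | ∃ (f : H →ₗ[F] F) (a : A), a ∈ I ∧ x = coactF ρ.toLinearMap f a} := by
  intro x hx b
  set J := Submodule.span F
    {x : A | ∃ (f : H →ₗ[F] F) (a : A), a ∈ I ∧ x = coactF ρ.toLinearMap f a}
  have mem (f : H →ₗ[F] F) {a : A} (ha : a ∈ I) :
      TensorProduct.rid F A (LinearMap.lTensor A f (ρ a)) ∈ J :=
    Submodule.subset_span ⟨f, a, ha, rfl⟩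
  let T : H →ₗ[F] H := (LinearEquiv.ofBijective (antipode F (A := H)) hS).symm.toLinearMap
  have hT : antipode F ∘ₗ T = LinearMap.id :=
    LinearMap.ext (LinearEquiv.ofBijective (antipode F (A := H)) hS).apply_symm_apply
  induction hx using Submodule.span_induction with
  | zero => simp
  | add x y _ _ hx hy =>
    exact ⟨by simpa [add_mul] using J.add_mem hx.1 hy.1,
      by simpa [mul_add] using J.add_mem hx.2 hy.2⟩
  | smul c x _ hx =>
    exact ⟨by simpa using J.smul_mem c hx.1, by simpa using J.smul_mem c hx.2⟩
  | mem x hx =>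
    obtain ⟨f, a, ha, rfl⟩ := hx
    simp only [coactF, AlgHom.toLinearMap_apply]
    constructor
    · rw [← rid_lTensor_mul_tmul_one, ← lTensor_assoc_rTensor_coaction ρ hcoassoc hcounit
        (LinearMap.mul' F H ∘ₗ LinearMap.lTensor H (antipode F)) mul_antipode_lTensor_comul b]
      induction ρ b with
      | zero => simp
      | add u v hu hv => simpa only [map_add, mul_add] using J.add_mem hu hv
      | tmul c h =>
        rw [LinearMap.rTensor_tmul, AlgHom.toLinearMap_apply, lTensor_mul_lTensor_assoc_tmul,
          ← mul_assoc, ← map_mul, rid_lTensor_mul_one_tmul]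
        exact mem _ (I.mul_mem_right _ _ ha)
    · rw [← rid_lTensor_tmul_one_mul, ← lTensor_assoc_rTensor_coaction ρ hcoassoc hcounit _
        (mul_rTensor_comm_comul_of_antipode_comp_eq_id hS.injective T hT) b]
      induction ρ b with
      | zero => simp
      | add u v hu hv => simpa only [map_add, add_mul] using J.add_mem hu hv
      | tmul c h =>
        rw [LinearMap.rTensor_tmul, AlgHom.toLinearMap_apply, lTensor_mul_rTensor_comm_assoc_tmul,
          mul_assoc, ← map_mul, rid_lTensor_one_tmul_mul]
        exact mem _ (I.mul_mem_left _ _ ha)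
end

section
/- Let B be a finite-dimensional semisimple associative unital (right) H-comodule algebra over a field F, where H is a Hopf algebra over F whose antipode is bijective. Then B decomposes as B = B₁ ⊕ B₂ ⊕ … ⊕ B_s, an internal direct sum of two-sided ideals each of which is an H-subcomodule (ρ(B_i) ⊆ B_i ⊗_F H), and each B_i is H-simple in the sense that B_i ≠ 0 and every two-sided ideal of B contained in B_i that is an H-subcomodule equals 0 or B_i. -/
open TensorProduct

/-- A submodule `V` of a (right) `H`-comodule `A` with structure map `ρ` is an `H`-subcomodule
if `ρ(V)` is contained in the canonical image of `V ⊗[F] H` in `A ⊗[F] H`. -/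
def IsSubcomodule {F : Type*} [Field F] {A H : Type*}
    [AddCommGroup A] [Module F A] [AddCommGroup H] [Module F H]
    (ρ : A →ₗ[F] A ⊗[F] H) (V : Submodule F A) : Prop :=
  ∀ v ∈ V, ρ v ∈ LinearMap.range (LinearMap.rTensor H V.subtype)

/-- In a semisimple ring every two-sided ideal contains an identity element for itself, and this
element is central in the whole ring. -/
theorem IsSemisimpleRing.exists_central_identity {B : Type*} [Ring B] [IsSemisimpleRing B]
    (I : AddSubgroup B) (hI : ∀ x ∈ I, ∀ b : B, x * b ∈ I ∧ b * x ∈ I) :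
    ∃ e ∈ I, (∀ x ∈ I, e * x = x) ∧ (∀ x ∈ I, x * e = x) ∧ ∀ b, e * b = b * e := by
  let L : Ideal B :=
    { I with smul_mem' := fun b x hx => (hI x hx b).2 }
  let R : Ideal Bᵐᵒᵖ :=
    { carrier := {x | x.unop ∈ I}
      add_mem' := fun hx hy => I.add_mem hx hy
      zero_mem' := I.zero_mem
      smul_mem' := fun b x hx => (hI _ hx b.unop).1 }
  obtain ⟨e, he, hLe⟩ := IsSemisimpleRing.ideal_eq_span_idempotent L
  obtain ⟨f, hf, hRf⟩ := IsSemisimpleRing.ideal_eq_span_idempotent R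
  have heI : e ∈ I := by
    change e ∈ L
    rw [hLe]
    exact Ideal.mem_span_singleton_self e
  have hfI : f.unop ∈ I := by
    change f ∈ R
    rw [hRf]
    exact Ideal.mem_span_singleton_self f
  have right_id : ∀ x ∈ I, x * e = x := fun x hx => by
    change x ∈ L at hx
    rw [hLe, Ideal.mem_span_singleton'] at hx
    obtain ⟨a, rfl⟩ := hx
    rw [mul_assoc, he.eq]
  have left_id : ∀ x ∈ I, f.unop * x = x := fun x hx => by
    have hx' : MulOpposite.op x ∈ R := hx
    rw [hRf, Ideal.mem_span_singleton'] at hx'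
    obtain ⟨a, ha⟩ := hx'
    have : MulOpposite.op x * f = MulOpposite.op x := by rw [← ha, mul_assoc, hf.eq]
    exact congrArg MulOpposite.unop this
  have hef : e = f.unop := (left_id e heI).symm.trans (right_id _ hfI)
  rw [← hef] at left_id
  refine ⟨e, heI, left_id, right_id, fun b => ?_⟩
  rw [← left_id _ (hI e heI b).2, ← mul_assoc, right_id _ (hI e heI b).1]

/-- Contraction of the second tensor factor by a linear functional. -/
noncomputable def TensorProduct.contractRight {F : Type*} [Field F] (A : Type*) {H : Type*}
    [AddCommGroup A] [Module F A] [AddCommGroup H] [Module F H] (f : H →ₗ[F] F) :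
    A ⊗[F] H →ₗ[F] A :=
  (TensorProduct.rid F A).toLinearMap ∘ₗ LinearMap.lTensor A f

@[simp]
theorem TensorProduct.contractRight_tmul {F : Type*} [Field F] {A H : Type*}
    [AddCommGroup A] [Module F A] [AddCommGroup H] [Module F H] (f : H →ₗ[F] F) (a : A) (h : H) :
    contractRight A f (a ⊗ₜ h) = f h • a := by
  simp [contractRight]

theorem TensorProduct.mem_range_rTensor_subtype_iff {F : Type*} [Field F] {A H : Type*}
    [AddCommGroup A] [Module F A] [AddCommGroup H] [Module F H] (V : Submodule F A)
    (z : A ⊗[F] H) :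
    z ∈ LinearMap.range (LinearMap.rTensor H V.subtype) ↔
      ∀ f : H →ₗ[F] F, contractRight A f z ∈ V := by
  constructor
  · rintro ⟨w, rfl⟩ f
    induction w with
    | zero => simp
    | add x y hx hy => simpa only [map_add] using V.add_mem hx hy
    | tmul v h => simpa using V.smul_mem (f h) v.2
  · intro hz
    let b := Module.Basis.ofVectorSpace F H
    obtain ⟨c, rfl⟩ := TensorProduct.eq_repr_basis_right b z
    have hc : ∀ i, c i ∈ V := fun i => by
      classical
      have := hz (b.coord i)
      have hsum : contractRight A (b.coord i) (c.sum fun j m => m ⊗ₜ b j) = c i := by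
        simp +contextual [Finsupp.sum, Finsupp.single_apply, Finset.sum_ite_eq, eq_comm]
      exact hsum ▸ this
    refine Submodule.sum_mem _ fun i _ => ⟨(⟨c i, hc i⟩ : V) ⊗ₜ b i, by simp⟩

section Comodule

variable {F : Type*} [Field F] {H : Type*} [Ring H] [HopfAlgebra F H]
  {B : Type*} [Ring B] [Algebra F B] (ρ : B →ₐ[F] B ⊗[F] H)

theorem isSubcomodule_iff (V : Submodule F B) :
    IsSubcomodule ρ.toLinearMap V ↔
      ∀ f : H →ₗ[F] F, ∀ v ∈ V, TensorProduct.contractRight B f (ρ v) ∈ V :=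
  ⟨fun h f v hv => (TensorProduct.mem_range_rTensor_subtype_iff V _).1 (h v hv) f,
    fun h v hv => (TensorProduct.mem_range_rTensor_subtype_iff V _).2 fun f => h f v hv⟩

theorem TensorProduct.contractRight_tmul_one_mul (f : H →ₗ[F] F) (e : B) (z : B ⊗[F] H) :
    contractRight B f ((e ⊗ₜ 1) * z) = e * contractRight B f z := by
  induction z with
  | zero => simp
  | add x y hx hy => simp only [mul_add, map_add, hx, hy]
  | tmul a h => simp

/-- The linear endomorphism `b ⊗ h ↦ ρ b * (1 ⊗ S h)` of `B ⊗ H`. -/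
noncomputable def coactionMulAntipode : B ⊗[F] H →ₗ[F] B ⊗[F] H :=
  LinearMap.mul' F (B ⊗[F] H) ∘ₗ TensorProduct.map ρ.toLinearMap
    (Algebra.TensorProduct.includeRight.toLinearMap ∘ₗ HopfAlgebra.antipode F)

@[simp]
theorem coactionMulAntipode_tmul (b : B) (h : H) :
    coactionMulAntipode ρ (b ⊗ₜ h) = ρ b * (1 ⊗ₜ HopfAlgebra.antipode F h) := by
  simp [coactionMulAntipode]

theorem coactionMulAntipode_eq (z : B ⊗[F] H) :
    coactionMulAntipode ρ z =
      LinearMap.lTensor B (LinearMap.mul' F H ∘ₗ (HopfAlgebra.antipode F).lTensor H)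
        (TensorProduct.assoc F B H H (LinearMap.rTensor H ρ.toLinearMap z)) := by
  induction z with
  | zero => simp
  | add x y hx hy => simp only [map_add, hx, hy]
  | tmul b h =>
    simp only [coactionMulAntipode_tmul, LinearMap.rTensor_tmul, AlgHom.toLinearMap_apply]
    induction ρ b with
    | zero => simp
    | add x y hx hy => simp only [add_mul, TensorProduct.add_tmul, map_add, hx, hy]
    | tmul a k => simp

theorem coactionMulAntipode_coaction
    (hcoassoc : ∀ a : B, (TensorProduct.assoc F B H H)
        ((LinearMap.rTensor H ρ.toLinearMap) (ρ a))
      = (LinearMap.lTensor B (Coalgebra.comul (R := F) (A := H))) (ρ a))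
    (hcounit : ∀ a : B, (TensorProduct.rid F B)
        ((LinearMap.lTensor B (Coalgebra.counit (R := F) (A := H))) (ρ a)) = a)
    (a : B) : coactionMulAntipode ρ (ρ a) = a ⊗ₜ 1 := by
  have hε : LinearMap.lTensor B (Coalgebra.counit (R := F) (A := H)) (ρ a) = a ⊗ₜ 1 :=
    (TensorProduct.rid F B).injective (by simpa using hcounit a)
  rw [coactionMulAntipode_eq, hcoassoc, ← LinearMap.comp_apply, ← LinearMap.lTensor_comp,
    LinearMap.comp_assoc, HopfAlgebra.mul_antipode_lTensor_comul, LinearMap.lTensor_comp,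
    LinearMap.comp_apply, hε]
  simp

/-- The identity element of a coinvariant ideal of a comodule algebra is coinvariant. -/
theorem coaction_identity_eq
    (hcoassoc : ∀ a : B, (TensorProduct.assoc F B H H)
        ((LinearMap.rTensor H ρ.toLinearMap) (ρ a))
      = (LinearMap.lTensor B (Coalgebra.comul (R := F) (A := H))) (ρ a))
    (hcounit : ∀ a : B, (TensorProduct.rid F B)
        ((LinearMap.lTensor B (Coalgebra.counit (R := F) (A := H))) (ρ a)) = a)
    {I : Submodule F B} (hI : IsSubcomodule ρ.toLinearMap I) {e : B} (heI : e ∈ I)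
    (left_id : ∀ x ∈ I, e * x = x) (right_id : ∀ x ∈ I, x * e = x) :
    ρ e = e ⊗ₜ 1 := by
  have fix : ρ e * coactionMulAntipode ρ (ρ e) = coactionMulAntipode ρ (ρ e) := by
    suffices ∀ w : I ⊗[F] H,
        ρ e * coactionMulAntipode ρ (LinearMap.rTensor H I.subtype w) =
          coactionMulAntipode ρ (LinearMap.rTensor H I.subtype w) by
      obtain ⟨w, hw⟩ := hI e heI
      rw [AlgHom.toLinearMap_apply] at hw
      simpa only [hw] using this w
    intro w
    induction w with
    | zero => simp
    | add x y hx hy => simp only [map_add, mul_add, hx, hy]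
    | tmul v h => simp [← mul_assoc, ← map_mul, left_id v v.2]
  have absorb : ρ e * (e ⊗ₜ 1) = ρ e := by
    obtain ⟨w, hw⟩ := hI e heI
    rw [AlgHom.toLinearMap_apply] at hw
    rw [← hw]
    clear hw
    induction w with
    | zero => simp
    | add x y hx hy => simp only [map_add, add_mul, hx, hy]
    | tmul v h => simp [right_id v v.2]
  rw [coactionMulAntipode_coaction ρ hcoassoc hcounit] at fix
  exact absorb.symm.trans fix

/-- The operators on a comodule algebra whose common invariant subspaces are the two-sided ideals
that are subcomodules. -/
def coinvariantIdealOperators : Set (Module.End F B) :=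
  Set.range (LinearMap.mulLeft F) ∪ Set.range (LinearMap.mulRight F) ∪
    Set.range fun f : H →ₗ[F] F => TensorProduct.contractRight B f ∘ₗ ρ.toLinearMap

theorem forall_coinvariantIdealOperators_iff (V : Submodule F B) :
    (∀ T ∈ coinvariantIdealOperators ρ, ∀ v ∈ V, T v ∈ V) ↔
      (∀ x ∈ V, ∀ b : B, x * b ∈ V ∧ b * x ∈ V) ∧ IsSubcomodule ρ.toLinearMap V := by
  rw [isSubcomodule_iff]
  constructor
  · intro h
    exact ⟨fun x hx b => ⟨h _ (.inl (.inr ⟨b, rfl⟩)) x hx, h _ (.inl (.inl ⟨b, rfl⟩)) x hx⟩,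
      fun f v hv => h _ (.inr ⟨f, rfl⟩) v hv⟩
  · rintro ⟨h₁, h₂⟩ T ((⟨b, rfl⟩ | ⟨b, rfl⟩) | ⟨f, rfl⟩) v hv
    exacts [(h₁ v hv b).2, (h₁ v hv b).1, h₂ f v hv]

/-- A complement of a coinvariant two-sided ideal of a semisimple comodule algebra. -/
theorem exists_isCompl_coinvariant_ideal [IsSemisimpleRing B]
    (hcoassoc : ∀ a : B, (TensorProduct.assoc F B H H)
        ((LinearMap.rTensor H ρ.toLinearMap) (ρ a))
      = (LinearMap.lTensor B (Coalgebra.comul (R := F) (A := H))) (ρ a))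
    (hcounit : ∀ a : B, (TensorProduct.rid F B)
        ((LinearMap.lTensor B (Coalgebra.counit (R := F) (A := H))) (ρ a)) = a)
    (I : Submodule F B) (hI : ∀ x ∈ I, ∀ b : B, x * b ∈ I ∧ b * x ∈ I)
    (hIρ : IsSubcomodule ρ.toLinearMap I) :
    ∃ J : Submodule F B, (∀ x ∈ J, ∀ b : B, x * b ∈ J ∧ b * x ∈ J) ∧
      IsSubcomodule ρ.toLinearMap J ∧ IsCompl I J := by
  obtain ⟨e, heI, left_id, right_id, comm⟩ :=
    IsSemisimpleRing.exists_central_identity I.toAddSubgroup hI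
  have hρe := coaction_identity_eq ρ hcoassoc hcounit hIρ heI left_id right_id
  have mem_ker : ∀ x, x ∈ LinearMap.ker (LinearMap.mulLeft F e) ↔ e * x = 0 := fun x => by simp
  refine ⟨LinearMap.ker (LinearMap.mulLeft F e), fun x hx b => ?_, ?_, ?_, ?_⟩
  · rw [mem_ker] at hx ⊢
    rw [mem_ker]
    exact ⟨by rw [← mul_assoc, hx, zero_mul],
      by rw [← mul_assoc, comm, mul_assoc, hx, mul_zero]⟩
  · rw [isSubcomodule_iff]
    intro f x hx
    rw [mem_ker] at hx ⊢
    rw [← TensorProduct.contractRight_tmul_one_mul, ← hρe, ← map_mul, hx, map_zero, map_zero]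
  · rw [Submodule.disjoint_def]
    intro x hx hx'
    rw [mem_ker] at hx'
    rw [← left_id x hx, hx']
  · rw [codisjoint_iff, Submodule.eq_top_iff']
    intro x
    refine Submodule.mem_sup.2 ⟨e * x, (hI e heI x).1, x - e * x, ?_, by abel⟩
    rw [mem_ker, mul_sub, ← mul_assoc, left_id e heI, sub_self]

end Comodule

/-- A subspace invariant under a set of operators, as a module over the algebra they generate. -/
def Submodule.ofAdjoinInvariant {F M : Type*} [Field F] [AddCommGroup M] [Module F M]
    (s : Set (Module.End F M)) (V : Submodule F M) (h : ∀ T ∈ s, ∀ v ∈ V, T v ∈ V) :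
    Submodule (Algebra.adjoin F s) M :=
  { V with
    smul_mem' := fun T v hv => by
      obtain ⟨T, hT⟩ := T
      change T v ∈ V
      change v ∈ V at hv
      induction hT using Algebra.adjoin_induction generalizing v with
      | mem T hT => exact h T hT v hv
      | algebraMap r => exact V.smul_mem r hv
      | add S T _ _ hS hT => exact V.add_mem (hS v hv) (hT v hv)
      | mul S T _ _ hS hT => exact hS _ (hT v hv) }

/-- A semisimple module of finite length is an internal direct sum of finitely many simple
submodules. -/
theorem IsSemisimpleModule.exists_isInternal_fin (R M : Type*) [Ring R] [AddCommGroup M]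
    [Module R M] [IsSemisimpleModule R M] [IsNoetherian R M] :
    ∃ (n : ℕ) (S : Fin n → Submodule R M), DirectSum.IsInternal S ∧ ∀ i, IsAtom (S i) := by
  obtain ⟨s, ind, hsup, simple⟩ := IsSemisimpleModule.exists_sSupIndep_sSup_simples_eq_top R M
  have : Finite s := (WellFoundedGT.finite_of_sSupIndep ind).to_subtype
  let σ := Finite.equivFin s
  refine ⟨Nat.card s, fun i => (σ.symm i).1, ?_,
    fun i => isSimpleModule_iff_isAtom.1 (simple _ (σ.symm i).2)⟩
  refine DirectSum.isInternal_submodule_of_iSupIndep_of_iSup_eq_top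
    (((sSupIndep_iff s).1 ind).comp σ.symm.injective) ?_
  rw [← hsup, sSup_eq_iSup']
  exact σ.symm.iSup_comp (g := fun x : s => (x : Submodule R M))


/-- Wedderburn–Artin theorem for `H`-comodule algebras: a finite-dimensional
semisimple `H`-comodule algebra (`H` a Hopf algebra with bijective antipode) is a direct sum
of `H`-simple `H`-coinvariant two-sided ideals. -/
theorem stmt2 {F : Type*} [Field F] {H : Type*} [Ring H] [HopfAlgebra F H]
    {B : Type*} [Ring B] [Algebra F B] [FiniteDimensional F B] [IsSemisimpleRing B]
    (ρ : B →ₐ[F] B ⊗[F] H)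
    (hcoassoc : ∀ a : B, (TensorProduct.assoc F B H H)
        ((LinearMap.rTensor H ρ.toLinearMap) (ρ a))
      = (LinearMap.lTensor B (Coalgebra.comul (R := F) (A := H))) (ρ a))
    (hcounit : ∀ a : B, (TensorProduct.rid F B)
        ((LinearMap.lTensor B (Coalgebra.counit (R := F) (A := H))) (ρ a)) = a)
    (hS : Function.Bijective (HopfAlgebra.antipode (R := F) (A := H))) :
    ∃ (s : ℕ) (𝒞 : Fin s → Submodule F B),
      DirectSum.IsInternal 𝒞 ∧
      (∀ i, ∀ x ∈ 𝒞 i, ∀ b : B, x * b ∈ 𝒞 i ∧ b * x ∈ 𝒞 i) ∧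
      (∀ i, IsSubcomodule ρ.toLinearMap (𝒞 i)) ∧
      (∀ i, 𝒞 i ≠ ⊥ ∧
        ∀ V : Submodule F B, V ≤ 𝒞 i →
          (∀ x ∈ V, ∀ b : B, x * b ∈ V ∧ b * x ∈ V) →
          IsSubcomodule ρ.toLinearMap V → V = ⊥ ∨ V = 𝒞 i) := by
  let R := Algebra.adjoin F (coinvariantIdealOperators ρ)
  let toR (V : Submodule F B) (h₁ : ∀ x ∈ V, ∀ b : B, x * b ∈ V ∧ b * x ∈ V)
      (h₂ : IsSubcomodule ρ.toLinearMap V) : Submodule R B :=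
    V.ofAdjoinInvariant _ ((forall_coinvariantIdealOperators_iff ρ V).2 ⟨h₁, h₂⟩)
  have ofR (N : Submodule R B) := (forall_coinvariantIdealOperators_iff ρ (N.restrictScalars F)).1
    fun T hT v hv => N.smul_mem ⟨T, Algebra.subset_adjoin hT⟩ hv
  have : IsSemisimpleModule R B := by
    refine { exists_isCompl := fun N => ?_ }
    obtain ⟨J, hJ₁, hJ₂, hJ⟩ := exists_isCompl_coinvariant_ideal ρ hcoassoc hcounit
      (N.restrictScalars F) (ofR N).1 (ofR N).2
    refine ⟨toR J hJ₁ hJ₂, ?_, ?_⟩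
    · have hdisj := Submodule.disjoint_def.1 hJ.disjoint
      exact Submodule.disjoint_def.2 hdisj
    · refine codisjoint_iff.2 (Submodule.eq_top_iff'.2 fun x => ?_)
      have hsup := Submodule.mem_sup.1 <|
        Submodule.eq_top_iff'.1 (codisjoint_iff.1 hJ.codisjoint) x
      exact Submodule.mem_sup.2 hsup
  have : IsNoetherian R B := isNoetherian_of_tower F inferInstance
  obtain ⟨s, C, hC, hatom⟩ := IsSemisimpleModule.exists_isInternal_fin R B
  refine ⟨s, fun i => (C i).restrictScalars F, hC, fun i => (ofR (C i)).1, fun i => (ofR (C i)).2,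
    fun i => ⟨fun h => (hatom i).1 ((Submodule.restrictScalars_eq_bot_iff F R B).1 h),
      fun V hV h₁ h₂ => ?_⟩⟩
  refine ((hatom i).le_iff.1 (show toR V h₁ h₂ ≤ C i from hV)).imp (fun h => ?_) fun h => ?_
  all_goals exact SetLike.ext fun x => SetLike.ext_iff.1 h x
end

section
/- Let A be a finite-dimensional (right) H-comodule algebra over a field F, where H is an involutory Hopf algebra over F (i.e. S ∘ S = id_H). Let Φ : A → End_F(A) be the left regular representation, Φ(a)b := ab. Then for every h* ∈ H* and every a ∈ A, tr(Φ(h*·a)) = h*(1_H) · tr(Φ(a)), where tr denotes the trace of an F-linear endomorphism of A. -/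
open TensorProduct

section ComoduleCoefficients

variable {F A H ι : Type*} [Field F] [AddCommGroup A] [Module F A]

/-- The `i`-th coordinate map `A ⊗ H → H` with respect to a basis of `A`. -/
noncomputable def tensorCoord [AddCommGroup H] [Module F H] (e : Module.Basis ι F A) (i : ι) :
    A ⊗[F] H →ₗ[F] H :=
  (TensorProduct.lid F H).toLinearMap ∘ₗ LinearMap.rTensor H (e.coord i)

@[simp]
lemma tensorCoord_tmul [AddCommGroup H] [Module F H] (e : Module.Basis ι F A) (i : ι)
    (a : A) (h : H) : tensorCoord e i (a ⊗ₜ[F] h) = e.repr a i • h := by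
  simp [tensorCoord]

lemma sum_basis_tmul_tensorCoord [Fintype ι] [AddCommGroup H] [Module F H]
    (e : Module.Basis ι F A) (x : A ⊗[F] H) :
    ∑ i, e i ⊗ₜ[F] tensorCoord e i x = x := by
  induction x with
  | zero => simp
  | tmul a h =>
    simp only [tensorCoord_tmul, ← TensorProduct.smul_tmul, ← TensorProduct.sum_tmul, e.sum_repr]
  | add x y hx hy => simp only [map_add, TensorProduct.tmul_add, Finset.sum_add_distrib, hx, hy]

lemma comul_tensorCoord [Fintype ι] [AddCommGroup H] [Module F H] [CoalgebraStruct F H]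
    (e : Module.Basis ι F A) (ρ : A →ₗ[F] A ⊗[F] H)
    (hcoassoc : ∀ a : A, (TensorProduct.assoc F A H H) (LinearMap.rTensor H ρ (ρ a))
      = LinearMap.lTensor A (Coalgebra.comul (R := F) (A := H)) (ρ a)) (i : ι) (a : A) :
    Coalgebra.comul (R := F) (tensorCoord e i (ρ a))
      = ∑ k, tensorCoord e i (ρ (e k)) ⊗ₜ[F] tensorCoord e k (ρ a) := by
  have hr (x : A ⊗[F] H) : tensorCoord e i (LinearMap.lTensor A Coalgebra.comul x)
      = Coalgebra.comul (R := F) (tensorCoord e i x) := by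
    induction x with
    | zero => simp
    | tmul a h => simp
    | add x y hx hy => simp only [map_add, hx, hy]
  have hl (x : A ⊗[F] H) (h : H) :
      tensorCoord e i (TensorProduct.assoc F A H H (x ⊗ₜ[F] h)) = tensorCoord e i x ⊗ₜ[F] h := by
    induction x with
    | zero => simp
    | tmul a h => simp [TensorProduct.smul_tmul']
    | add x y hx hy => simp only [map_add, TensorProduct.add_tmul, hx, hy]
  rw [← hr, ← hcoassoc]
  conv_lhs => rw [← sum_basis_tmul_tensorCoord e (ρ a)]
  simp only [map_sum, LinearMap.rTensor_tmul, hl]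

lemma counit_tensorCoord [AddCommGroup H] [Module F H] [CoalgebraStruct F H]
    (e : Module.Basis ι F A) (x : A ⊗[F] H) (i : ι) :
    Coalgebra.counit (R := F) (tensorCoord e i x)
      = e.repr (TensorProduct.rid F A (LinearMap.lTensor A Coalgebra.counit x)) i := by
  induction x with
  | zero => simp
  | tmul a h => simp [mul_comm]
  | add x y hx hy => simp only [map_add, hx, hy, Finsupp.add_apply]

end ComoduleCoefficients

section ComoduleAlgebra

variable {F A H ι : Type*} [Field F] [Ring A] [Algebra F A]

lemma tensorCoord_mul_one_tmul [Ring H] [Algebra F H] (e : Module.Basis ι F A) (i : ι)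
    (x : A ⊗[F] H) (h : H) :
    tensorCoord e i (x * (1 ⊗ₜ[F] h)) = tensorCoord e i x * h := by
  induction x with
  | zero => simp
  | tmul a g => simp
  | add x y hx hy => simp only [map_add, add_mul, hx, hy]

lemma sum_tensorCoord_mul_basis_tmul_one [Fintype ι] [Ring H] [Algebra F H]
    (e : Module.Basis ι F A) (x : A ⊗[F] H) :
    ∑ i, tensorCoord e i (x * (e i ⊗ₜ[F] 1))
      = TensorProduct.lid F H
          (LinearMap.rTensor H (LinearMap.trace F A ∘ₗ LinearMap.mul F A) x) := by
  classical
  induction x with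
  | zero => simp
  | tmul a h =>
    simp [← Finset.sum_smul, LinearMap.trace_eq_matrix_trace F e, Matrix.trace,
      LinearMap.toMatrix_apply]
  | add x y hx hy => simp only [map_add, add_mul, Finset.sum_add_distrib, hx, hy]

variable [Fintype ι] [Ring H] [HopfAlgebra F H]

lemma sum_tensorCoord_mul_antipode [DecidableEq ι] (e : Module.Basis ι F A)
    (ρ : A →ₗ[F] A ⊗[F] H)
    (hcoassoc : ∀ a : A, (TensorProduct.assoc F A H H) (LinearMap.rTensor H ρ (ρ a))
      = LinearMap.lTensor A (Coalgebra.comul (R := F) (A := H)) (ρ a))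
    (hcounit : ∀ a : A, TensorProduct.rid F A
      (LinearMap.lTensor A (Coalgebra.counit (R := F) (A := H)) (ρ a)) = a) (i j : ι) :
    ∑ k, tensorCoord e i (ρ (e k)) * HopfAlgebra.antipode F (tensorCoord e k (ρ (e j)))
      = if i = j then 1 else 0 := by
  have h := HopfAlgebra.mul_antipode_lTensor_comul_apply (R := F) (tensorCoord e i (ρ (e j)))
  rw [comul_tensorCoord e ρ hcoassoc, counit_tensorCoord, hcounit] at h
  simpa [Finsupp.single_apply, eq_comm, apply_ite (algebraMap F H)] using h

/-- The form `a ↦ tr Φ(a)` is `H`-colinear when the antipode is an involution. -/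
theorem trace_mulLeft_colinear (e : Module.Basis ι F A) (ρ : A →ₐ[F] A ⊗[F] H)
    (hcoassoc : ∀ a : A, (TensorProduct.assoc F A H H)
      (LinearMap.rTensor H ρ.toLinearMap (ρ a))
      = LinearMap.lTensor A (Coalgebra.comul (R := F) (A := H)) (ρ a))
    (hcounit : ∀ a : A, TensorProduct.rid F A
      (LinearMap.lTensor A (Coalgebra.counit (R := F) (A := H)) (ρ a)) = a)
    (hinv : ∀ h : H, HopfAlgebra.antipode F (HopfAlgebra.antipode F h) = h) (a : A) :
    TensorProduct.lid F H
        (LinearMap.rTensor H (LinearMap.trace F A ∘ₗ LinearMap.mul F A) (ρ a))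
      = LinearMap.trace F A (LinearMap.mulLeft F a) • (1 : H) := by
  classical
  let c (i j : ι) : H := tensorCoord e i (ρ (e j))
  let S : H →ₗ[F] H := HopfAlgebra.antipode F
  have hS (i j : ι) : ∑ k, c i k * S (c k j) = if i = j then 1 else 0 :=
    sum_tensorCoord_mul_antipode e ρ.toLinearMap hcoassoc hcounit i j
  have hS' (i j : ι) : ∑ k, c k j * S (c i k) = if i = j then 1 else 0 := by
    have h := congrArg S (hS i j)
    simpa [S, HopfAlgebra.antipode_mul_antidistrib, hinv, apply_ite] using h
  have hρ (i : ι) : ∑ j, ρ (e j) * (1 ⊗ₜ[F] S (c j i)) = e i ⊗ₜ[F] (1 : H) := by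
    rw [← sum_basis_tmul_tensorCoord e (∑ j, ρ (e j) * (1 ⊗ₜ[F] S (c j i)))]
    simp only [map_sum, tensorCoord_mul_one_tmul]
    change ∑ k, e k ⊗ₜ[F] (∑ j, c k j * S (c j i)) = _
    simp [hS, TensorProduct.tmul_ite]
  have hmul (i k : ι) : tensorCoord e i (ρ (a * e k))
      = ∑ l, e.repr (a * e k) l • c i l := by
    conv_lhs => rw [← e.sum_repr (a * e k)]
    simp only [map_sum, map_smul, c]
  rw [← sum_tensorCoord_mul_basis_tmul_one e]
  calc ∑ i, tensorCoord e i (ρ a * (e i ⊗ₜ[F] 1))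
      = ∑ i, ∑ j, ∑ l, e.repr (a * e j) l • (c i l * S (c j i)) := by
        refine Finset.sum_congr rfl fun i _ => ?_
        simp only [← hρ, Finset.mul_sum, ← mul_assoc, ← map_mul, map_sum,
          tensorCoord_mul_one_tmul, hmul, Finset.sum_mul, smul_mul_assoc]
    _ = ∑ j, ∑ l, e.repr (a * e j) l • ∑ i, c i l * S (c j i) := by
        rw [Finset.sum_comm]
        refine Finset.sum_congr rfl fun j _ => ?_
        rw [Finset.sum_comm]
        simp only [Finset.smul_sum]
    _ = LinearMap.trace F A (LinearMap.mulLeft F a) • (1 : H) := by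
        simp only [hS', smul_ite, smul_zero, Finset.sum_ite_eq, Finset.mem_univ, if_true,
          ← Finset.sum_smul, LinearMap.trace_eq_matrix_trace F e, Matrix.trace, Matrix.diag_apply,
          LinearMap.toMatrix_apply, LinearMap.mulLeft_apply]

end ComoduleAlgebra

/-- for a finite-dimensional `H`-comodule algebra `A` over an involutory Hopf
algebra `H`, with `Φ` the left regular representation, `tr Φ(h^* · a) = h^*(1) tr Φ(a)`. -/
theorem stmt3 {F : Type*} [Field F] {H : Type*} [Ring H] [HopfAlgebra F H]
    {A : Type*} [Ring A] [Algebra F A] [FiniteDimensional F A]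
    (ρ : A →ₐ[F] A ⊗[F] H)
    (hcoassoc : ∀ a : A, (TensorProduct.assoc F A H H)
        ((LinearMap.rTensor H ρ.toLinearMap) (ρ a))
      = (LinearMap.lTensor A (Coalgebra.comul (R := F) (A := H))) (ρ a))
    (hcounit : ∀ a : A, (TensorProduct.rid F A)
        ((LinearMap.lTensor A (Coalgebra.counit (R := F) (A := H))) (ρ a)) = a)
    (hinv : ∀ h : H, HopfAlgebra.antipode (R := F)
      (HopfAlgebra.antipode (R := F) h) = h)
    (f : H →ₗ[F] F) (a : A) :
    LinearMap.trace F A (LinearMap.mulLeft F (coactF ρ.toLinearMap f a))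
      = f 1 * LinearMap.trace F A (LinearMap.mulLeft F a) := by
  have hf (x : A ⊗[F] H) : LinearMap.trace F A (LinearMap.mulLeft F
      (TensorProduct.rid F A (LinearMap.lTensor A f x)))
      = f (TensorProduct.lid F H
          (LinearMap.rTensor H (LinearMap.trace F A ∘ₗ LinearMap.mul F A) x)) := by
    change (LinearMap.trace F A ∘ₗ LinearMap.mul F A) _ = _
    induction x with
    | zero => simp
    | tmul a h => simp [mul_comm]
    | add x y hx hy => simp only [map_add, hx, hy]
  have h := trace_mulLeft_colinear (Module.finBasis F A) ρ hcoassoc hcounit hinv a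
  rw [coactF, hf, AlgHom.toLinearMap_apply, h, map_smul, smul_eq_mul, mul_comm]
end

section
/- Let A be a finite-dimensional (right) H-comodule algebra over a field F, where H is an involutory Hopf algebra (S ∘ S = id_H), and suppose there exist m ∈ ℕ, elements a₁, …, a_m in the Jacobson radical J(A), and functionals h₁*, …, h_m* ∈ H*. If Φ : A → End_F(A) denotes the left regular representation Φ(a)b := ab, then tr(Φ((h₁*·a₁)(h₂*·a₂)⋯(h_m*·a_m))) = 0. -/
open TensorProduct

/-- Slicing a tensor by a linear functional on the left factor. -/
noncomputable def sliceLeft {F A H : Type*} [Field F] [AddCommGroup A] [Module F A]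
    [AddCommGroup H] [Module F H] (φ : A →ₗ[F] F) : A ⊗[F] H →ₗ[F] H :=
  (TensorProduct.lid F H).toLinearMap ∘ₗ LinearMap.rTensor H φ

@[simp]
lemma sliceLeft_tmul {F A H : Type*} [Field F] [AddCommGroup A] [Module F A]
    [AddCommGroup H] [Module F H] (φ : A →ₗ[F] F) (x : A) (h : H) :
    sliceLeft φ (x ⊗ₜ[F] h) = φ x • h := by
  simp [sliceLeft]

section Slice

variable {F H A ι : Type*} [Field F] [Ring H] [Algebra F H] [Ring A] [Algebra F A]

lemma sliceLeft_mul_one_tmul (φ : A →ₗ[F] F) (X : A ⊗[F] H) (h : H) :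
    sliceLeft φ (X * (1 ⊗ₜ h)) = sliceLeft φ X * h := by
  induction X with
  | zero => simp
  | tmul x y => simp
  | add X Y hX hY => simp [add_mul, hX, hY]

lemma apply_sliceLeft (φ : A →ₗ[F] F) (f : H →ₗ[F] F) (X : A ⊗[F] H) :
    f (sliceLeft φ X) = φ (TensorProduct.rid F A (LinearMap.lTensor A f X)) := by
  induction X with
  | zero => simp
  | tmul x y => simp [mul_comm]
  | add X Y hX hY => simp [hX, hY]

lemma rid_lTensor_mul (f : H →ₗ[F] F) (X : A ⊗[F] H) (b : A) :
    TensorProduct.rid F A (LinearMap.lTensor A f X) * b =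
      TensorProduct.rid F A (LinearMap.lTensor A f (X * (b ⊗ₜ 1))) := by
  induction X with
  | zero => simp
  | tmul x y => simp
  | add X Y hX hY => simp [add_mul, hX, hY]

variable [Fintype ι] (e : Module.Basis ι F A)

lemma sum_basis_tmul_sliceLeft (X : A ⊗[F] H) : ∑ i, e i ⊗ₜ[F] sliceLeft (e.coord i) X = X := by
  induction X with
  | zero => simp
  | tmul x y =>
    simp only [sliceLeft_tmul, TensorProduct.tmul_smul, TensorProduct.smul_tmul',
      ← TensorProduct.sum_tmul, Module.Basis.coord_apply, e.sum_repr]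
  | add X Y hX hY => simp [TensorProduct.tmul_add, Finset.sum_add_distrib, hX, hY]

/-- The regular trace functional `a ↦ tr (b ↦ a * b)`. -/
noncomputable def regTrace (F A : Type*) [Field F] [Ring A] [Algebra F A] : A →ₗ[F] F :=
  LinearMap.trace F A ∘ₗ LinearMap.mul F A

lemma regTrace_eq_sum_coord (x : A) : regTrace F A x = ∑ i, e.coord i (x * e i) := by
  classical
  simp [regTrace, LinearMap.trace_eq_matrix_trace F e, Matrix.trace, LinearMap.toMatrix_apply]

lemma sliceLeft_regTrace (X : A ⊗[F] H) :
    sliceLeft (regTrace F A) X = ∑ i, sliceLeft (e.coord i) (X * (e i ⊗ₜ 1)) := by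
  induction X with
  | zero => simp
  | tmul x y => simp [regTrace_eq_sum_coord e, Finset.sum_smul]
  | add X Y hX hY => simp [add_mul, Finset.sum_add_distrib, hX, hY]

end Slice

section Comodule

variable {F H A ι : Type*} [Field F] [Ring H] [HopfAlgebra F H] [Ring A] [Algebra F A]
  [Fintype ι] [DecidableEq ι]

open HopfAlgebra

lemma comul_coeff (e : Module.Basis ι F A) (ρ : A →ₗ[F] A ⊗[F] H) (c : ι → ι → H)
    (hc : ∀ j, ρ (e j) = ∑ i, e i ⊗ₜ c i j)
    (hcoassoc : ∀ a : A, (TensorProduct.assoc F A H H) ((LinearMap.rTensor H ρ) (ρ a))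
      = (LinearMap.lTensor A (Coalgebra.comul (R := F) (A := H))) (ρ a)) (i j : ι) :
    Coalgebra.comul (R := F) (c i j) = ∑ k, c i k ⊗ₜ[F] c k j := by
  have h := congrArg (sliceLeft (e.coord i)) (hcoassoc (e j))
  simpa [hc, TensorProduct.sum_tmul, Finsupp.single_apply] using h.symm

lemma counit_coeff (e : Module.Basis ι F A) (ρ : A →ₗ[F] A ⊗[F] H) (c : ι → ι → H)
    (hc : ∀ j, ρ (e j) = ∑ i, e i ⊗ₜ c i j)
    (hcounit : ∀ a : A, (TensorProduct.rid F A)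
        ((LinearMap.lTensor A (Coalgebra.counit (R := F) (A := H))) (ρ a)) = a) (i j : ι) :
    Coalgebra.counit (R := F) (c i j) = if i = j then 1 else 0 := by
  have h := congrArg (e.coord i) (hcounit (e j))
  simpa [hc, Finsupp.single_apply, eq_comm] using h

lemma sum_coeff_mul_antipode
    {c : ι → ι → H}
    (hΔ : ∀ i j, Coalgebra.comul (R := F) (c i j) = ∑ k, c i k ⊗ₜ[F] c k j)
    (hε : ∀ i j, Coalgebra.counit (R := F) (c i j) = if i = j then 1 else 0)
    (i j : ι) :
    ∑ k, c i k * antipode F (c k j) = if i = j then 1 else 0 := by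
  have h := mul_antipode_lTensor_comul_apply (R := F) (c i j)
  rw [hΔ, hε] at h
  simpa [apply_ite] using h

lemma sum_coeff_mul_antipode_transpose
    {c : ι → ι → H}
    (hΔ : ∀ i j, Coalgebra.comul (R := F) (c i j) = ∑ k, c i k ⊗ₜ[F] c k j)
    (hε : ∀ i j, Coalgebra.counit (R := F) (c i j) = if i = j then 1 else 0)
    (hinv : ∀ h : H, antipode F (antipode F h) = h) (i j : ι) :
    ∑ k, c k i * antipode F (c j k) = if i = j then 1 else 0 := by
  have h := congrArg (antipode F) (sum_coeff_mul_antipode hΔ hε j i)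
  simpa [antipode_mul_antidistrib, hinv, apply_ite, eq_comm (a := j)] using h

lemma basis_tmul_one
    {c : ι → ι → H}
    (hΔ : ∀ i j, Coalgebra.comul (R := F) (c i j) = ∑ k, c i k ⊗ₜ[F] c k j)
    (hε : ∀ i j, Coalgebra.counit (R := F) (c i j) = if i = j then 1 else 0)
    (e : Module.Basis ι F A) (ρ : A →ₗ[F] A ⊗[F] H)
    (hc : ∀ j, ρ (e j) = ∑ i, e i ⊗ₜ c i j) (j : ι) :
    e j ⊗ₜ[F] (1 : H) = ∑ k, ρ (e k) * (1 ⊗ₜ antipode F (c k j)) := by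
  simp_rw [hc, Finset.sum_mul, Algebra.TensorProduct.tmul_mul_tmul, mul_one]
  rw [Finset.sum_comm]
  simp_rw [← TensorProduct.tmul_sum, sum_coeff_mul_antipode hΔ hε]
  simp [TensorProduct.tmul_ite]

lemma map_mul_basis_tmul_one
    {c : ι → ι → H}
    (hΔ : ∀ i j, Coalgebra.comul (R := F) (c i j) = ∑ k, c i k ⊗ₜ[F] c k j)
    (hε : ∀ i j, Coalgebra.counit (R := F) (c i j) = if i = j then 1 else 0)
    (e : Module.Basis ι F A) (ρ : A →ₐ[F] A ⊗[F] H)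
    (hc : ∀ j, ρ (e j) = ∑ i, e i ⊗ₜ c i j) (a : A) (j : ι) :
    ρ a * (e j ⊗ₜ[F] (1 : H)) = ∑ k, ρ (a * e k) * (1 ⊗ₜ antipode F (c k j)) := by
  rw [basis_tmul_one hΔ hε e ρ.toLinearMap hc, Finset.mul_sum]
  simp [mul_assoc]

lemma sliceLeft_regTrace_coaction
    {c : ι → ι → H}
    (hΔ : ∀ i j, Coalgebra.comul (R := F) (c i j) = ∑ k, c i k ⊗ₜ[F] c k j)
    (hε : ∀ i j, Coalgebra.counit (R := F) (c i j) = if i = j then 1 else 0)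
    (e : Module.Basis ι F A) (ρ : A →ₐ[F] A ⊗[F] H)
    (hc : ∀ j, ρ (e j) = ∑ i, e i ⊗ₜ c i j)
    (hinv : ∀ h : H, antipode F (antipode F h) = h) (a : A) :
    sliceLeft (regTrace F A) (ρ a) = regTrace F A a • (1 : H) := by
  have key (j k : ι) : sliceLeft (e.coord j) (ρ (a * e k)) =
      ∑ i, e.coord i (a * e k) • c j i := by
    conv_lhs => rw [← e.sum_repr (a * e k)]
    simp [-map_mul, -Module.Basis.sum_repr, hc, Finsupp.single_apply]
  rw [sliceLeft_regTrace e, regTrace_eq_sum_coord e]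
  simp_rw [map_mul_basis_tmul_one hΔ hε e ρ hc, map_sum, sliceLeft_mul_one_tmul, key,
    Finset.sum_mul, smul_mul_assoc]
  rw [Finset.sum_comm, Finset.sum_smul]
  refine Finset.sum_congr rfl fun k _ => ?_
  rw [Finset.sum_comm]
  simp_rw [← Finset.smul_sum, sum_coeff_mul_antipode_transpose hΔ hε hinv]
  simp

end Comodule

/-- If the regular trace vanishes on `a * A`, it vanishes on `(f · a) * A`. -/
lemma regTrace_coactF_mul_eq_zero {F H A : Type*} [Field F] [Ring H] [HopfAlgebra F H]
    [Ring A] [Algebra F A] [FiniteDimensional F A] (ρ : A →ₐ[F] A ⊗[F] H)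
    (hcoassoc : ∀ a : A, (TensorProduct.assoc F A H H)
        ((LinearMap.rTensor H ρ.toLinearMap) (ρ a))
      = (LinearMap.lTensor A (Coalgebra.comul (R := F) (A := H))) (ρ a))
    (hcounit : ∀ a : A, (TensorProduct.rid F A)
        ((LinearMap.lTensor A (Coalgebra.counit (R := F) (A := H))) (ρ a)) = a)
    (hinv : ∀ h : H, HopfAlgebra.antipode (R := F) (HopfAlgebra.antipode (R := F) h) = h)
    (a : A) (ha : ∀ x, regTrace F A (a * x) = 0) (f : H →ₗ[F] F) (b : A) :
    regTrace F A (coactF ρ.toLinearMap f a * b) = 0 := by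
  let e := Module.finBasis F A
  let c := fun i j => sliceLeft (e.coord i) (ρ (e j))
  have hc (j) : ρ (e j) = ∑ i, e i ⊗ₜ c i j := (sum_basis_tmul_sliceLeft e _).symm
  have hΔ := comul_coeff e ρ.toLinearMap c hc hcoassoc
  have hε := counit_coeff e ρ.toLinearMap c hc hcounit
  suffices h : regTrace F A ∘ₗ LinearMap.mulLeft F (coactF ρ.toLinearMap f a) = 0 from
    LinearMap.congr_fun h b
  refine e.ext fun j => ?_
  simp only [LinearMap.comp_apply, LinearMap.mulLeft_apply, LinearMap.zero_apply, coactF,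
    AlgHom.toLinearMap_apply]
  rw [rid_lTensor_mul, ← apply_sliceLeft, map_mul_basis_tmul_one hΔ hε e ρ hc]
  simp [-map_mul, sliceLeft_mul_one_tmul, sliceLeft_regTrace_coaction hΔ hε e ρ hc hinv, ha]

lemma regTrace_eq_zero_of_mem_jacobson {F A : Type*} [Field F] [Ring A] [Algebra F A]
    [FiniteDimensional F A] {a : A} (ha : a ∈ (⊥ : Ideal A).jacobson) : regTrace F A a = 0 := by
  have : IsArtinianRing A := IsArtinianRing.of_finite F A
  obtain ⟨n, hn⟩ := IsArtinianRing.isNilpotent_jacobson_bot (R := A)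
  have hnil : IsNilpotent a := ⟨n, by simpa [hn] using Ideal.pow_mem_pow ha n⟩
  exact (LinearMap.isNilpotent_trace_of_isNilpotent
    (hnil.map (Algebra.lmul F A))).eq_zero

/-- for a finite-dimensional `H`-comodule algebra `A` over an involutory Hopf
algebra `H`, elements `a₁, …, a_m` of the Jacobson radical `J(A)` and functionals
`h₁^*, …, h_m^* ∈ H^*`, the trace of left multiplication by
`(h₁^* · a₁) ⋯ (h_m^* · a_m)` vanishes. -/
theorem stmt4 {F : Type*} [Field F] {H : Type*} [Ring H] [HopfAlgebra F H]
    {A : Type*} [Ring A] [Algebra F A] [FiniteDimensional F A]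
    (ρ : A →ₐ[F] A ⊗[F] H)
    (hcoassoc : ∀ a : A, (TensorProduct.assoc F A H H)
        ((LinearMap.rTensor H ρ.toLinearMap) (ρ a))
      = (LinearMap.lTensor A (Coalgebra.comul (R := F) (A := H))) (ρ a))
    (hcounit : ∀ a : A, (TensorProduct.rid F A)
        ((LinearMap.lTensor A (Coalgebra.counit (R := F) (A := H))) (ρ a)) = a)
    (hinv : ∀ h : H, HopfAlgebra.antipode (R := F)
      (HopfAlgebra.antipode (R := F) h) = h)
    (m : ℕ) (hm : 0 < m) (a : Fin m → A)
    (ha : ∀ i, a i ∈ (⊥ : Ideal A).jacobson)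
    (f : Fin m → (H →ₗ[F] F)) :
    LinearMap.trace F A (LinearMap.mulLeft F
      ((List.ofFn fun i => coactF ρ.toLinearMap (f i) (a i)).prod)) = 0 := by
  obtain ⟨n, rfl⟩ := Nat.exists_eq_add_one_of_ne_zero hm.ne'
  rw [List.ofFn_succ, List.prod_cons]
  refine regTrace_coactF_mul_eq_zero ρ hcoassoc hcounit hinv (a 0) (fun x => ?_) (f 0) _
  refine regTrace_eq_zero_of_mem_jacobson ?_
  have h0 := ha 0
  rw [Ideal.jacobson_bot] at h0 ⊢
  exact Ideal.mul_mem_right _ _ h0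
end

section
/- Let G be a group and let A be a finite-dimensional associative unital algebra over a field F equipped with a G-grading A = ⊕_{g∈G} A^{(g)} (with A^{(g)} A^{(h)} ⊆ A^{(gh)} for all g, h ∈ G). Suppose that either char F = 0 or char F > dim_F A. Then the Jacobson radical J(A) is a graded (homogeneous) ideal of A, i.e. J(A) = ⊕_{g∈G} (J(A) ∩ A^{(g)}). -/
/-- A non-nilpotent element of a finite-dimensional algebra has a nonzero idempotent multiple. -/
theorem exists_isIdempotentElem_mul_of_not_isNilpotent (F : Type*) {A : Type*} [Field F] [Ring A]
    [Algebra F A] [FiniteDimensional F A] {a : A} (ha : ¬ IsNilpotent a) :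
    ∃ b : A, IsIdempotentElem (a * b) ∧ a * b ≠ 0 := by
  open Polynomial in
  obtain ⟨q, hpq, hq⟩ := (minpoly F a).exists_eq_pow_rootMultiplicity_mul_and_not_dvd
    (minpoly.ne_zero (Algebra.IsIntegral.isIntegral a)) 0
  generalize (minpoly F a).rootMultiplicity 0 = m at hpq
  rw [C_0, sub_zero] at hpq hq
  obtain ⟨u, v, huv⟩ : IsCoprime (X ^ (m + 1)) q :=
    (((irreducible_X (R := F)).coprime_iff_not_dvd).2 hq).pow_left
  have hmin : a ^ m * aeval a q = 0 := by
    simpa using (congrArg (aeval a) hpq).symm.trans (minpoly.aeval F a)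
  have hone : aeval a (X ^ (m + 1) * u) + aeval a (q * v) = 1 := by
    rw [← map_add, mul_comm _ u, mul_comm q, huv, map_one]
  have hmul : a * aeval a (X ^ m * u) = aeval a (X ^ (m + 1) * u) := by
    conv_lhs => enter [1]; rw [← aeval_X (R := F) a]
    rw [← map_mul]
    ring_nf
  have hzero : aeval a (X ^ (m + 1) * u) * aeval a (q * v) = 0 := by
    rw [← map_mul, show X ^ (m + 1) * u * (q * v) = X ^ m * q * (X * u * v) by ring,
      map_mul, map_mul, map_pow, aeval_X, hmin, zero_mul]
  refine ⟨aeval a (X ^ m * u), ?_, fun h => ha ⟨m, ?_⟩⟩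
  · rw [hmul]
    have := congrArg (aeval a (X ^ (m + 1) * u) * ·) hone
    simpa only [IsIdempotentElem, mul_add, hzero, add_zero, mul_one] using this
  · rw [hmul.symm.trans h, zero_add] at hone
    rw [← mul_one (a ^ m), ← hone, map_mul, ← mul_assoc, hmin, zero_mul]

theorem natCast_ne_zero_of_lt_ringChar {F : Type*} [Field F] {n r : ℕ}
    (hchar : ringChar F = 0 ∨ n < ringChar F) (hr : r ≠ 0) (hrn : r ≤ n) : (r : F) ≠ 0 := by
  intro h
  have hdvd := (ringChar.spec F r).1 h
  rcases hchar with h0 | hlt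
  · exact hr (by simpa [h0] using hdvd)
  · exact absurd (Nat.le_of_dvd (Nat.pos_of_ne_zero hr) hdvd) (by omega)

theorem isNilpotent_of_mem_jacobson_bot (F : Type*) {A : Type*} [Field F] [Ring A]
    [Algebra F A] [FiniteDimensional F A] {a : A} (ha : a ∈ (⊥ : Ideal A).jacobson) :
    IsNilpotent a := by
  have : IsArtinianRing A := IsArtinianRing.of_finite F A
  obtain ⟨n, hn⟩ := IsArtinianRing.isNilpotent_jacobson_bot (R := A)
  refine ⟨n, ?_⟩
  have := Ideal.pow_mem_pow ha n
  rwa [hn] at this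

section

/-- The trace of left multiplication by an element of a possibly noncommutative algebra. -/
noncomputable def leftRegularTrace (F A : Type*) [Field F] [Ring A] [Algebra F A] : A →ₗ[F] F :=
  (LinearMap.trace F A).comp (Algebra.lmul F A).toLinearMap

variable {F A : Type*} [Field F] [Ring A] [Algebra F A]

theorem leftRegularTrace_apply (a : A) :
    leftRegularTrace F A a = LinearMap.trace F A (Algebra.lmul F A a) := rfl

theorem leftRegularTrace_mul_comm (a b : A) :
    leftRegularTrace F A (a * b) = leftRegularTrace F A (b * a) := by
  simp only [leftRegularTrace_apply, map_mul]
  exact LinearMap.trace_mul_comm _ _ _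

theorem leftRegularTrace_eq_zero_of_isNilpotent {a : A} (ha : IsNilpotent a) :
    leftRegularTrace F A a = 0 :=
  (LinearMap.isNilpotent_trace_of_isNilpotent (ha.map (Algebra.lmul F A))).eq_zero

variable [FiniteDimensional F A]

theorem leftRegularTrace_ne_zero_of_isIdempotentElem
    (hchar : ringChar F = 0 ∨ Module.finrank F A < ringChar F)
    {e : A} (he : IsIdempotentElem e) (hne : e ≠ 0) : leftRegularTrace F A e ≠ 0 := by
  have hid : IsIdempotentElem (Algebra.lmul F A e) := he.map (Algebra.lmul F A)
  rw [leftRegularTrace_apply, (LinearMap.IsIdempotentElem.isProj_range _ hid).trace]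
  refine natCast_ne_zero_of_lt_ringChar hchar (fun h => hne ?_) (Submodule.finrank_le _)
  have h0 := LinearMap.range_eq_bot.1 (Submodule.finrank_eq_zero.1 h)
  simpa using LinearMap.congr_fun h0 1

theorem isNilpotent_of_forall_leftRegularTrace_mul_eq_zero
    (hchar : ringChar F = 0 ∨ Module.finrank F A < ringChar F)
    {a : A} (ha : ∀ b, leftRegularTrace F A (a * b) = 0) : IsNilpotent a := by
  by_contra hnil
  obtain ⟨b, hb, hne⟩ := exists_isIdempotentElem_mul_of_not_isNilpotent F hnil
  exact leftRegularTrace_ne_zero_of_isIdempotentElem hchar hb hne (ha b)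

/-- The Jacobson radical is the radical of the trace form when the characteristic is zero or
larger than the dimension. -/
theorem mem_jacobson_bot_iff_forall_leftRegularTrace_mul_eq_zero
    (hchar : ringChar F = 0 ∨ Module.finrank F A < ringChar F) {a : A} :
    a ∈ (⊥ : Ideal A).jacobson ↔ ∀ b, leftRegularTrace F A (a * b) = 0 := by
  refine ⟨fun ha b => ?_, fun ha => Ideal.mem_jacobson_iff.2 fun y => ?_⟩
  · rw [leftRegularTrace_mul_comm]
    exact leftRegularTrace_eq_zero_of_isNilpotent
      (isNilpotent_of_mem_jacobson_bot F (Ideal.mul_mem_left _ b ha))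
  · have hnil : IsNilpotent (y * a) :=
      isNilpotent_of_forall_leftRegularTrace_mul_eq_zero hchar fun b => by
        rw [mul_assoc, leftRegularTrace_mul_comm, mul_assoc, ha]
    obtain ⟨z, hz⟩ := hnil.isUnit_add_one.exists_left_inv
    refine ⟨z, ?_⟩
    rw [Ideal.mem_bot, mul_assoc, sub_eq_zero, ← hz, mul_add, mul_one]

theorem leftRegularTrace_eq_zero_of_mem_of_ne_one {G : Type*} [Group G] [DecidableEq G]
    {𝒜 : G → Submodule F A} (hmul : ∀ g h : G, ∀ a ∈ 𝒜 g, ∀ b ∈ 𝒜 h, a * b ∈ 𝒜 (g * h))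
    (hdecomp : DirectSum.IsInternal 𝒜) {g : G} (hg : g ≠ 1) {a : A} (ha : a ∈ 𝒜 g) :
    leftRegularTrace F A a = 0 :=
  LinearMap.trace_eq_zero_of_mapsTo_ne hdecomp (g * ·) (fun _ hh => hg (mul_eq_right.1 hh))
    fun _ b hb => hmul g _ a ha b hb

end

/-- the Jacobson radical of a finite-dimensional associative unital algebra graded
by an arbitrary group `G`, over a field `F` with `char F = 0` or `char F > dim_F A`, is a graded
ideal. -/
theorem stmt6 {F : Type*} [Field F] {G : Type*} [Group G] [DecidableEq G]
    {A : Type*} [Ring A] [Algebra F A] [FiniteDimensional F A]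
    (𝒜 : G → Submodule F A)
    (hmul : ∀ g h : G, ∀ a ∈ 𝒜 g, ∀ b ∈ 𝒜 h, a * b ∈ 𝒜 (g * h))
    (hdecomp : DirectSum.IsInternal 𝒜)
    (hchar : ringChar F = 0 ∨ Module.finrank F A < ringChar F) :
    Submodule.restrictScalars F ((⊥ : Ideal A).jacobson)
      = ⨆ g : G, Submodule.restrictScalars F ((⊥ : Ideal A).jacobson) ⊓ 𝒜 g := by
  classical
  refine le_antisymm (fun a ha => ?_) (iSup_le fun g => inf_le_left)
  let := hdecomp.chooseDecomposition
  have hsum := DirectSum.sum_support_decompose 𝒜 a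
  rw [← hsum]
  refine Submodule.sum_mem _ fun g _ => Submodule.mem_iSup_of_mem g ⟨?_, SetLike.coe_mem _⟩
  refine (mem_jacobson_bot_iff_forall_leftRegularTrace_mul_eq_zero hchar).2 fun b => ?_
  have hb : b ∈ ⨆ h, 𝒜 h := hdecomp.submodule_iSup_eq_top ▸ Submodule.mem_top
  induction hb using Submodule.iSup_induction' with
  | zero => simp
  | add x y _ _ hx hy => rw [mul_add, map_add, hx, hy, add_zero]
  | mem h b hb =>
    have hoff (k : G) (hk : k * h ≠ 1) :
        leftRegularTrace F A ((DirectSum.decompose 𝒜 a k : A) * b) = 0 :=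
      leftRegularTrace_eq_zero_of_mem_of_ne_one hmul hdecomp hk
        (hmul k h _ (SetLike.coe_mem _) b hb)
    by_cases hgh : g * h = 1
    · have htr := (mem_jacobson_bot_iff_forall_leftRegularTrace_mul_eq_zero hchar).1 ha b
      rw [← hsum, Finset.sum_mul, map_sum, Finset.sum_eq_single g] at htr
      · exact htr
      · exact fun k _ hkg => hoff k fun hk => hkg (mul_right_cancel (hk.trans hgh.symm))
      · intro hg
        simp [DFinsupp.notMem_support_iff.1 hg]
    · exact hoff g hgh
end

section
/- Let G be a group and let A be a finite-dimensional associative unital algebra over a field F of characteristic 0, equipped with a G-grading A = ⊕_{g∈G} A^{(g)}. Then there exists a unital F-subalgebra B ⊆ A such that B is a semisimple ring, B is a graded subspace of A (i.e. B = ⊕_{g∈G} (B ∩ A^{(g)})), and A = B ⊕ J(A) as F-vector spaces (internal direct sum). -/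
/-- The trace of left multiplication by an element of a (possibly noncommutative) algebra. -/
noncomputable def regularTrace (F A : Type*) [Field F] [Ring A] [Algebra F A] : A →ₗ[F] F :=
  LinearMap.trace F A ∘ₗ (Algebra.lmul F A).toLinearMap

section RegularTrace

variable {F A : Type*} [Field F] [Ring A] [Algebra F A]

lemma regularTrace_mul_comm (a b : A) : regularTrace F A (a * b) = regularTrace F A (b * a) := by
  change LinearMap.trace F A (Algebra.lmul F A (a * b)) =
    LinearMap.trace F A (Algebra.lmul F A (b * a))
  rw [map_mul (Algebra.lmul F A), map_mul (Algebra.lmul F A), LinearMap.trace_mul_comm]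

lemma regularTrace_eq_zero_of_isNilpotent [FiniteDimensional F A] {a : A} (ha : IsNilpotent a) :
    regularTrace F A a = 0 :=
  (LinearMap.isNilpotent_trace_of_isNilpotent (ha.map (Algebra.lmul F A))).eq_zero

lemma eq_zero_of_isIdempotentElem_of_regularTrace_eq_zero [CharZero F] [FiniteDimensional F A]
    {e : A} (he : IsIdempotentElem e) (ht : regularTrace F A e = 0) : e = 0 := by
  have hp := (LinearMap.isProj_range_iff_isIdempotentElem (Algebra.lmul F A e)).2
    (he.map (Algebra.lmul F A))
  have h := hp.trace
  have ht' : LinearMap.trace F A (Algebra.lmul F A e) = 0 := ht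
  rw [ht', eq_comm, Nat.cast_eq_zero, Submodule.finrank_eq_zero, LinearMap.range_eq_bot] at h
  simpa using LinearMap.congr_fun h 1

open Polynomial in
/-- An element all of whose positive powers have zero trace is nilpotent. -/
lemma isNilpotent_of_forall_regularTrace_mul_aeval [CharZero F] [FiniteDimensional F A] {x : A}
    (hx : ∀ p : F[X], regularTrace F A (aeval x p * x) = 0) : IsNilpotent x := by
  have hint : IsIntegral F x := Algebra.IsIntegral.isIntegral x
  obtain ⟨q, hq, hndvd⟩ :=
    exists_eq_pow_rootMultiplicity_mul_and_not_dvd (minpoly F x) (minpoly.ne_zero hint) 0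
  set k := rootMultiplicity 0 (minpoly F x)
  rw [C_0, sub_zero] at hq hndvd
  obtain ⟨u, v, huv⟩ : IsCoprime (X ^ (k + 1)) q :=
    ((irreducible_X.coprime_iff_not_dvd).2 hndvd).pow_left
  have hmin : aeval x (X ^ k * q) = 0 := by rw [← hq, minpoly.aeval]
  have hv : aeval x (X ^ (k + 1) * q) = 0 := by
    rw [pow_succ', mul_assoc, map_mul, hmin, mul_zero]
  have hidem : IsIdempotentElem (aeval x (u * X ^ (k + 1))) := by
    have h : u * X ^ (k + 1) * (u * X ^ (k + 1))
        = u * X ^ (k + 1) - u * v * (X ^ (k + 1) * q) := by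
      linear_combination u * X ^ (k + 1) * huv
    rw [IsIdempotentElem, ← map_mul, h, map_sub, map_mul _ (u * v), hv, mul_zero, sub_zero]
  have hzero : aeval x (u * X ^ (k + 1)) = 0 := by
    refine eq_zero_of_isIdempotentElem_of_regularTrace_eq_zero (F := F) hidem ?_
    rw [pow_succ, ← mul_assoc, map_mul, aeval_X]
    exact hx _
  refine ⟨k + 1, ?_⟩
  have h : (X : F[X]) ^ (k + 1) = X ^ (k + 1) * (u * X ^ (k + 1)) + v * (X ^ (k + 1) * q) := by
    linear_combination -(X ^ (k + 1) * huv)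
  have h' := congrArg (aeval x) h
  rwa [map_add, map_mul, hzero, map_mul _ v, hv, mul_zero, mul_zero, add_zero, map_pow,
    aeval_X] at h'

/-- The Jacobson radical is the radical of the trace form. -/
lemma mem_jacobson_iff_forall_regularTrace [CharZero F] [FiniteDimensional F A] {a : A} :
    a ∈ Ring.jacobson A ↔ ∀ b, regularTrace F A (b * a) = 0 := by
  have : IsArtinianRing A := IsArtinianRing.of_finite F A
  constructor
  · intro ha b
    obtain ⟨n, hn⟩ := IsArtinianRing.isNilpotent_jacobson_bot (R := A)
    refine regularTrace_eq_zero_of_isNilpotent ⟨n, ?_⟩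
    have h := Ideal.pow_mem_pow (Ideal.mul_mem_left _ b ha) n
    rwa [← Ideal.jacobson_bot, hn] at h
  · intro h
    rw [← Ideal.jacobson_bot, Ideal.mem_jacobson_iff]
    intro y
    have hnil : IsNilpotent (y * a) := isNilpotent_of_forall_regularTrace_mul_aeval (F := F)
      fun p => by rw [← mul_assoc]; exact h _
    obtain ⟨z, hz⟩ := hnil.isUnit_add_one.exists_left_inv
    refine ⟨z, ?_⟩
    rw [← hz]
    simp [mul_add, mul_assoc]

end RegularTrace

section Graded

open DirectSum

variable {F G A : Type*} [Field F] [Group G] [DecidableEq G] [Ring A] [Algebra F A]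
  [FiniteDimensional F A] (𝒜 : G → Submodule F A)

lemma regularTrace_eq_zero_of_mem [Decomposition 𝒜]
    (hmul : ∀ g h : G, ∀ a ∈ 𝒜 g, ∀ b ∈ 𝒜 h, a * b ∈ 𝒜 (g * h))
    {g : G} (hg : g ≠ 1) {a : A} (ha : a ∈ 𝒜 g) : regularTrace F A a = 0 :=
  LinearMap.trace_eq_zero_of_mapsTo_ne (Decomposition.isInternal 𝒜) (g * ·)
    (fun i => by simpa using hg) fun i b hb => hmul g i a ha b hb

lemma regularTrace_mul_decompose [Decomposition 𝒜]
    (hmul : ∀ g h : G, ∀ a ∈ 𝒜 g, ∀ b ∈ 𝒜 h, a * b ∈ 𝒜 (g * h))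
    {g h : G} {b : A} (hb : b ∈ 𝒜 h) (a : A) :
    regularTrace F A (b * decompose 𝒜 a g)
      = if h * g = 1 then regularTrace F A (b * a) else 0 := by
  split_ifs with hgh
  · induction a using Decomposition.inductionOn 𝒜 with
    | zero => simp
    | @homogeneous i m =>
      by_cases hi : i = g
      · subst hi; simp
      · rw [decompose_of_mem_ne 𝒜 m.2 hi, mul_zero, map_zero,
          regularTrace_eq_zero_of_mem 𝒜 hmul _ (hmul h i b hb m m.2)]
        exact fun h' => hi (mul_left_cancel (h'.trans hgh.symm))
    | add x y hx hy => simp [mul_add, hx, hy]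
  · exact regularTrace_eq_zero_of_mem 𝒜 hmul hgh (hmul h g b hb _ (decompose 𝒜 a g).2)

/-- In characteristic zero the Jacobson radical is a graded ideal. -/
lemma decompose_mem_jacobson [CharZero F] [Decomposition 𝒜]
    (hmul : ∀ g h : G, ∀ a ∈ 𝒜 g, ∀ b ∈ 𝒜 h, a * b ∈ 𝒜 (g * h))
    {a : A} (ha : a ∈ Ring.jacobson A) (g : G) : (decompose 𝒜 a g : A) ∈ Ring.jacobson A := by
  rw [mem_jacobson_iff_forall_regularTrace (F := F)] at ha ⊢
  intro b
  induction b using Decomposition.inductionOn 𝒜 with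
  | zero => simp
  | @homogeneous i m => rw [regularTrace_mul_decompose 𝒜 hmul m.2, ha, ite_self]
  | add x y hx hy => rw [add_mul, map_add, hx, hy, add_zero]

/-- The image of a decomposition under a surjective map with graded kernel. -/
lemma isInternal_map {F G V W : Type*} [Field F] [DecidableEq G] [AddCommGroup V] [Module F V]
    [AddCommGroup W] [Module F W] (𝒱 : G → Submodule F V) [Decomposition 𝒱] {f : V →ₗ[F] W}
    (hf : Function.Surjective f) (hker : ∀ v, f v = 0 → ∀ g, f (decompose 𝒱 v g) = 0) :
    IsInternal fun g => (𝒱 g).map f := by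
  rw [isInternal_submodule_iff_iSupIndep_and_iSup_eq_top]
  constructor
  · rw [iSupIndep_iff_finsetSum_eq_zero_imp_eq_zero]
    intro s w hw hsum i hi
    choose! v hv hvw using hw
    have h : f (∑ j ∈ s, v j) = 0 := by
      rw [map_sum, ← hsum]
      exact Finset.sum_congr rfl hvw
    have h' := hker _ h i
    rw [decompose_sum, DFinsupp.finsetSum_apply, AddSubmonoidClass.coe_finsetSum,
      Finset.sum_eq_single_of_mem i hi, decompose_of_mem_same 𝒱 (hv i hi), hvw i hi] at h'
    · exact h'
    · intro j hj hji
      exact decompose_of_mem_ne 𝒱 (hv j hj) hji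
  · rw [← Submodule.map_iSup, (Decomposition.isInternal 𝒱).submodule_iSup_eq_top,
      Submodule.map_top, LinearMap.range_eq_top.2 hf]

end Graded

section DualBases

variable {F S ι : Type*} [Field F] [Ring S] [Algebra F S] [Fintype ι] [DecidableEq ι]
  {x y : Module.Basis ι F S}

lemma repr_eq_regularTrace_mul
    (hxy : ∀ i j, regularTrace F S (x j * y i) = if j = i then 1 else 0) (v : S) (i : ι) :
    x.repr v i = regularTrace F S (v * y i) := by
  conv_rhs => rw [← x.sum_repr v]
  simp [-Module.Basis.sum_repr, Finset.sum_mul, hxy]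

lemma repr_eq_regularTrace_mul'
    (hxy : ∀ i j, regularTrace F S (x j * y i) = if j = i then 1 else 0) (v : S) (j : ι) :
    y.repr v j = regularTrace F S (x j * v) := by
  conv_rhs => rw [← y.sum_repr v]
  simp [-Module.Basis.sum_repr, Finset.mul_sum, hxy]

lemma sum_regularTrace_smul_left
    (hxy : ∀ i j, regularTrace F S (x j * y i) = if j = i then 1 else 0) (v : S) :
    ∑ j, regularTrace F S (v * y j) • x j = v := by
  simp_rw [← repr_eq_regularTrace_mul hxy, x.sum_repr]

lemma sum_regularTrace_smul_right
    (hxy : ∀ i j, regularTrace F S (x j * y i) = if j = i then 1 else 0) (v : S) :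
    ∑ j, regularTrace F S (x j * v) • y j = v := by
  simp_rw [← repr_eq_regularTrace_mul' hxy, y.sum_repr]

/-- The Casimir element of the trace form commutes with the algebra. -/
lemma sum_casimir_mul_comm {M : Type*} [AddCommGroup M] [Module F M]
    (hxy : ∀ i j, regularTrace F S (x j * y i) = if j = i then 1 else 0)
    (β : S →ₗ[F] S →ₗ[F] M) (b : S) :
    ∑ i, β (b * x i) (y i) = ∑ i, β (x i) (y i * b) := by
  have h1 (i : ι) : β (b * x i) (y i) = ∑ j, regularTrace F S (b * x i * y j) • β (x j) (y i) := by
    conv_lhs => rw [← sum_regularTrace_smul_left hxy (b * x i)]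
    simp
  have h2 (i : ι) :
      β (x i) (y i * b) = ∑ j, regularTrace F S (x j * (y i * b)) • β (x i) (y j) := by
    conv_lhs => rw [← sum_regularTrace_smul_right hxy (y i * b)]
    simp
  simp_rw [h1, h2]
  rw [Finset.sum_comm]
  refine Finset.sum_congr rfl fun i _ => Finset.sum_congr rfl fun j _ => ?_
  rw [mul_assoc, regularTrace_mul_comm, mul_assoc]

/-- The Casimir element of the trace form is a separability idempotent. -/
lemma sum_casimir_mul_eq_one
    (hxy : ∀ i j, regularTrace F S (x j * y i) = if j = i then 1 else 0) :
    ∑ i, x i * y i = 1 := by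
  have htr (a : S) : regularTrace F S (a * ∑ i, x i * y i) = regularTrace F S a := by
    have h : regularTrace F S a = LinearMap.trace F S (Algebra.lmul F S a) := rfl
    rw [h, LinearMap.trace_eq_matrix_trace F x, Matrix.trace]
    simp [LinearMap.toMatrix_apply, repr_eq_regularTrace_mul hxy, Finset.mul_sum, mul_assoc]
  rw [← sum_regularTrace_smul_right hxy (∑ i, x i * y i)]
  simp_rw [htr]
  simpa using sum_regularTrace_smul_right hxy 1

end DualBases

open DirectSum in
/-- A graded algebra with zero Jacobson radical has homogeneous dual bases for the trace form. -/
lemma exists_homogeneous_dual_bases {F G S : Type*} [Field F] [CharZero F] [Group G]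
    [DecidableEq G] [Ring S] [Algebra F S] [FiniteDimensional F S] (𝒮 : G → Submodule F S)
    [Decomposition 𝒮] (hmul : ∀ g h : G, ∀ a ∈ 𝒮 g, ∀ b ∈ 𝒮 h, a * b ∈ 𝒮 (g * h))
    (hS : Ring.jacobson S = ⊥) :
    ∃ (n : ℕ) (d : Fin n → G) (x y : Module.Basis (Fin n) F S),
      (∀ i, x i ∈ 𝒮 (d i)) ∧ (∀ i, y i ∈ 𝒮 (d i)⁻¹) ∧
      ∀ i j, regularTrace F S (x j * y i) = if j = i then 1 else 0 := by
  let c := (Decomposition.isInternal 𝒮).collectedBasis fun g => Module.finBasis F (𝒮 g)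
  have : Fintype (Σ g, Fin (Module.finrank F (𝒮 g))) := FiniteDimensional.fintypeBasisIndex c
  let e := Fintype.equivFin (Σ g, Fin (Module.finrank F (𝒮 g)))
  let x := c.reindex e
  have hx (i) : x i ∈ 𝒮 (e.symm i).1 := by
    rw [Module.Basis.reindex_apply]
    exact (Decomposition.isInternal 𝒮).collectedBasis_mem _ _
  let B : LinearMap.BilinForm F S := (LinearMap.mul F S).compr₂ (regularTrace F S)
  have hBapply (a b : S) : B a b = regularTrace F S (a * b) := rfl
  have hleft (a : S) (ha : ∀ b, regularTrace F S (b * a) = 0) : a = 0 := by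
    rwa [← mem_jacobson_iff_forall_regularTrace, hS, Ideal.mem_bot] at ha
  have hB : B.Nondegenerate :=
    ⟨fun a ha => hleft a fun b => by rw [regularTrace_mul_comm]; exact ha b, hleft⟩
  let y := B.dualBasis hB x
  have hxy (i j) : regularTrace F S (x j * y i) = if j = i then 1 else 0 := by
    rw [regularTrace_mul_comm]
    exact LinearMap.BilinForm.apply_dualBasis_left hB x i j
  refine ⟨_, fun i => (e.symm i).1, x, y, hx, fun i => ?_, hxy⟩
  have hy : (decompose 𝒮 (y i) (e.symm i).1⁻¹ : S) = y i := by
    rw [← sum_regularTrace_smul_right hxy (decompose 𝒮 (y i) (e.symm i).1⁻¹ : S)]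
    conv_rhs => rw [← sum_regularTrace_smul_right hxy (y i)]
    refine Finset.sum_congr rfl fun j _ => ?_
    rw [regularTrace_mul_decompose 𝒮 hmul (hx j)]
    split_ifs with h
    · rfl
    · rw [hxy, if_neg]
      rintro rfl
      exact h (mul_inv_cancel _)
  exact hy ▸ (decompose 𝒮 (y i) (e.symm i).1⁻¹).2

section Lifting

variable {F G A S ι : Type*} [Field F] [Group G] [Ring A] [Algebra F A] [Ring S] [Algebra F S]
  [Fintype ι] [DecidableEq ι] {𝒜 : G → Submodule F A} {𝒮 : G → Submodule F S}
  {J : Ideal A} [J.IsTwoSided] {π : A →ₐ[F] S} {d : ι → G} {x y : Module.Basis ι F S}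

/-- A graded linear section which is multiplicative modulo a power of the kernel can be corrected
to one which is multiplicative modulo the next power. -/
lemma exists_section_mul_sub_mem_pow_succ
    (hmulA : ∀ g h : G, ∀ a ∈ 𝒜 g, ∀ b ∈ 𝒜 h, a * b ∈ 𝒜 (g * h))
    (hmulS : ∀ g h : G, ∀ a ∈ 𝒮 g, ∀ b ∈ 𝒮 h, a * b ∈ 𝒮 (g * h))
    (hker : ∀ a, a ∈ J ↔ π a = 0)
    (hx : ∀ i, x i ∈ 𝒮 (d i)) (hy : ∀ i, y i ∈ 𝒮 (d i)⁻¹)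
    (hxy : ∀ i j, regularTrace F S (x j * y i) = if j = i then 1 else 0)
    {s : S →ₗ[F] A} (hs : ∀ v, π (s v) = v) (hsg : ∀ g, ∀ v ∈ 𝒮 g, s v ∈ 𝒜 g)
    {k : ℕ} (hk : ∀ v w, s v * s w - s (v * w) ∈ J ^ (k + 1)) :
    ∃ s' : S →ₗ[F] A, (∀ v, π (s' v) = v) ∧ (∀ g, ∀ v ∈ 𝒮 g, s' v ∈ 𝒜 g) ∧
      ∀ v w, s' v * s' w - s' (v * w) ∈ J ^ (k + 2) := by
  let t : S →ₗ[F] A := ∑ i, LinearMap.mulRight F (s (y i)) ∘ₗ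
    (LinearMap.mulRight F (s (x i)) ∘ₗ s - s ∘ₗ LinearMap.mulRight F (x i))
  have ht (v : S) : t v = ∑ i, (s v * s (x i) - s (v * x i)) * s (y i) := by
    simp [t]
  have hle : J ^ (k + 1) ≤ J := Ideal.pow_le_self k.succ_ne_zero
  have htk (v : S) : t v ∈ J ^ (k + 1) := by
    rw [ht]
    exact sum_mem fun i _ => Ideal.mul_mem_right _ _ (hk v (x i))
  have hone : 1 - ∑ i, s (x i) * s (y i) ∈ J := by
    simp [hker, hs, sum_casimir_mul_eq_one hxy]
  have hmem {a b : A} (ha : a ∈ J ^ (k + 1)) (hb : b ∈ J) : a * b ∈ J ^ (k + 2) := by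
    rw [J.pow_succ]
    exact Ideal.mul_mem_mul ha hb
  refine ⟨s - t, fun v => ?_, fun g v hv => ?_, fun v w => ?_⟩
  · rw [LinearMap.sub_apply, map_sub, hs, (hker _).1 (hle (htk v)), sub_zero]
  · rw [LinearMap.sub_apply, ht]
    refine sub_mem (hsg g v hv) (sum_mem fun i _ => ?_)
    have h := hmulA _ _ _ (sub_mem (hmulA _ _ _ (hsg _ _ hv) _ (hsg _ _ (hx i)))
      (hsg _ _ (hmulS _ _ _ hv _ (hx i)))) _ (hsg _ _ (hy i))
    rwa [mul_inv_cancel_right] at h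
  · have hcas : ∑ i, (s v * s (w * x i) - s (v * (w * x i))) * s (y i)
        = ∑ i, (s v * s (x i) - s (v * x i)) * s (y i * w) :=
      sum_casimir_mul_comm hxy ((LinearMap.mul F A).compl₁₂
        (LinearMap.mulLeft F (s v) ∘ₗ s - s ∘ₗ LinearMap.mulLeft F v) s) w
    have hcocycle : s v * t w - t (v * w)
        + ∑ i, (s v * s (w * x i) - s (v * (w * x i))) * s (y i)
        = (s v * s w - s (v * w)) * ∑ i, s (x i) * s (y i) := by
      rw [ht, ht, Finset.mul_sum, Finset.mul_sum, ← Finset.sum_sub_distrib,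
        ← Finset.sum_add_distrib]
      refine Finset.sum_congr rfl fun i _ => ?_
      rw [mul_assoc v w (x i)]
      noncomm_ring
    have hright : t v * s w = ∑ i, (s v * s (x i) - s (v * x i)) * s (y i * w)
        + ∑ i, (s v * s (x i) - s (v * x i)) * (s (y i) * s w - s (y i * w)) := by
      rw [ht, Finset.sum_mul, ← Finset.sum_add_distrib]
      refine Finset.sum_congr rfl fun i _ => ?_
      rw [← mul_add, add_sub_cancel, mul_assoc]
    have hmain : (s - t) v * (s - t) w - (s - t) (v * w)
        = (s v * s w - s (v * w)) * (1 - ∑ i, s (x i) * s (y i))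
          - ∑ i, (s v * s (x i) - s (v * x i)) * (s (y i) * s w - s (y i * w))
          + t v * t w := by
      rw [mul_sub, ← hcocycle, hcas, mul_one, ← sub_eq_iff_eq_add'.2 hright]
      simp only [LinearMap.sub_apply]
      noncomm_ring
    rw [hmain]
    exact add_mem (sub_mem (hmem (hk v w) hone)
      (sum_mem fun i _ => hmem (hk _ _) (hle (hk _ _)))) (hmem (htk v) (hle (htk w)))

/-- A surjection with nilpotent kernel onto an algebra with homogeneous dual bases for the trace
form has a graded algebra section. -/
lemma exists_graded_algHom_section [DecidableEq G] [FiniteDimensional F S]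
    [DirectSum.Decomposition 𝒮]
    (hmulA : ∀ g h : G, ∀ a ∈ 𝒜 g, ∀ b ∈ 𝒜 h, a * b ∈ 𝒜 (g * h))
    (hmulS : ∀ g h : G, ∀ a ∈ 𝒮 g, ∀ b ∈ 𝒮 h, a * b ∈ 𝒮 (g * h))
    (hker : ∀ a, a ∈ J ↔ π a = 0) (hJ : IsNilpotent J)
    (hlift : ∀ g, 𝒮 g ≤ (𝒜 g).map π.toLinearMap)
    (hx : ∀ i, x i ∈ 𝒮 (d i)) (hy : ∀ i, y i ∈ 𝒮 (d i)⁻¹)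
    (hxy : ∀ i j, regularTrace F S (x j * y i) = if j = i then 1 else 0) :
    ∃ s : S →ₐ[F] A, (∀ v, π (s v) = v) ∧ ∀ g, ∀ v ∈ 𝒮 g, s v ∈ 𝒜 g := by
  have happrox (k : ℕ) : ∃ s : S →ₗ[F] A, (∀ v, π (s v) = v) ∧ (∀ g, ∀ v ∈ 𝒮 g, s v ∈ 𝒜 g) ∧
      ∀ v w, s v * s w - s (v * w) ∈ J ^ (k + 1) := by
    induction k with
    | zero =>
      choose u hu hux using fun i => hlift _ (hx i)
      have hux' (i) : π (u i) = x i := hux i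
      have hs (v : S) : π (x.constr F u v) = v := by
        have h : π.toLinearMap ∘ₗ x.constr F u = LinearMap.id :=
          x.ext fun i => by simp [hux']
        exact LinearMap.congr_fun h v
      refine ⟨x.constr F u, hs, fun g v hv => ?_, fun v w => ?_⟩
      · rw [← sum_regularTrace_smul_left hxy v, map_sum]
        refine sum_mem fun j _ => ?_
        rw [map_smul, Module.Basis.constr_basis]
        by_cases hj : d j = g
        · exact Submodule.smul_mem _ _ (hj ▸ hu j)
        · rw [regularTrace_eq_zero_of_mem 𝒮 hmulS _ (hmulS _ _ _ hv _ (hy j)), zero_smul]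
          · exact zero_mem _
          · rw [Ne, mul_inv_eq_one]
            exact fun h => hj h.symm
      · rw [zero_add, J.pow_one, hker, map_sub, map_mul, hs, hs, hs, sub_self]
    | succ k ih =>
      obtain ⟨s, hs, hsg, hk⟩ := ih
      exact exists_section_mul_sub_mem_pow_succ hmulA hmulS hker hx hy hxy hs hsg hk
  obtain ⟨n, hn⟩ := hJ
  obtain ⟨s, hs, hsg, hk⟩ := happrox n
  have hmul (v w : S) : s (v * w) = s v * s w := by
    have h := Ideal.pow_le_pow_right n.le_succ (hk v w)
    rw [hn] at h
    exact (sub_eq_zero.1 h).symm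
  have hone : s 1 = 1 := by
    have hidem : IsIdempotentElem (1 - s 1) := by
      refine IsIdempotentElem.one_sub ?_
      rw [IsIdempotentElem, ← hmul, one_mul]
    have hmem : 1 - s 1 ∈ J := by rw [hker, map_sub, map_one, hs, sub_self]
    have h := Ideal.pow_le_pow_right n.le_succ (Ideal.pow_mem_pow hmem (n + 1))
    rw [hn, hidem.pow_succ_eq] at h
    exact (sub_eq_zero.1 h).symm
  exact ⟨AlgHom.ofLinearMap s hone hmul, hs, hsg⟩

end Lifting

/-- graded Wedderburn–Malcev theorem in characteristic `0`: a finite-dimensional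
associative unital algebra graded by an arbitrary group `G` over a field of characteristic `0`
admits a graded semisimple subalgebra `B` with `A = B ⊕ J(A)` as vector spaces. -/
theorem stmt7 {F : Type*} [Field F] [CharZero F] {G : Type*} [Group G] [DecidableEq G]
    {A : Type*} [Ring A] [Algebra F A] [FiniteDimensional F A]
    (𝒜 : G → Submodule F A)
    (hmul : ∀ g h : G, ∀ a ∈ 𝒜 g, ∀ b ∈ 𝒜 h, a * b ∈ 𝒜 (g * h))
    (hdecomp : DirectSum.IsInternal 𝒜) :
    ∃ B : Subalgebra F A,
      IsSemisimpleRing B ∧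
      Subalgebra.toSubmodule B
        = (⨆ g : G, Subalgebra.toSubmodule B ⊓ 𝒜 g) ∧
      IsCompl (Subalgebra.toSubmodule B)
        (Submodule.restrictScalars F ((⊥ : Ideal A).jacobson)) := by
  have : IsArtinianRing A := IsArtinianRing.of_finite F A
  rw [Ideal.jacobson_bot]
  let J := Ring.jacobson A
  let π : A →ₐ[F] A ⧸ J := Ideal.Quotient.mkₐ F J
  have hker (a : A) : a ∈ J ↔ π a = 0 := Ideal.Quotient.eq_zero_iff_mem.symm
  have hπ : Function.Surjective π := Ideal.Quotient.mkₐ_surjective F J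
  let _ := hdecomp.chooseDecomposition
  let 𝒮 : G → Submodule F (A ⧸ J) := fun g => (𝒜 g).map π.toLinearMap
  have h𝒮 : DirectSum.IsInternal 𝒮 := isInternal_map 𝒜 hπ fun a ha g =>
    (hker _).1 (decompose_mem_jacobson 𝒜 hmul ((hker a).2 ha) g)
  let _ := h𝒮.chooseDecomposition
  have hmulS : ∀ g h : G, ∀ a ∈ 𝒮 g, ∀ b ∈ 𝒮 h, a * b ∈ 𝒮 (g * h) := by
    rintro g h _ ⟨a, ha, rfl⟩ _ ⟨b, hb, rfl⟩
    exact ⟨a * b, hmul g h a ha b hb, map_mul π a b⟩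
  obtain ⟨n, d, x, y, hx, hy, hxy⟩ :=
    exists_homogeneous_dual_bases 𝒮 hmulS (Ring.jacobson_quotient_jacobson A)
  have hJ : IsNilpotent J := by
    have h := IsArtinianRing.isNilpotent_jacobson_bot (R := A)
    rwa [Ideal.jacobson_bot] at h
  obtain ⟨s, hs, hsg⟩ :=
    exists_graded_algHom_section hmul hmulS hker hJ (fun _ => le_rfl) hx hy hxy
  have hmem {a : A} : a ∈ Subalgebra.toSubmodule s.range ↔ ∃ v, s v = a := Iff.rfl
  refine ⟨s.range, ?_, le_antisymm ?_ (iSup_le fun g => inf_le_left), ?_⟩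
  · have : IsSemisimpleRing (A ⧸ J) := inferInstanceAs (IsSemisimpleRing (A ⧸ Ring.jacobson A))
    exact (AlgEquiv.ofInjective s (Function.LeftInverse.injective hs)).toRingEquiv.isSemisimpleRing
  · rintro _ ⟨v, rfl⟩
    change s v ∈ _
    rw [← x.sum_repr v, map_sum]
    refine sum_mem fun i _ => ?_
    rw [map_smul]
    exact Submodule.smul_mem _ _
      (Submodule.mem_iSup_of_mem (d i) ⟨hmem.2 ⟨_, rfl⟩, hsg _ _ (hx i)⟩)
  · constructor
    · rw [Submodule.disjoint_def]
      rintro _ ⟨v, rfl⟩ hv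
      have h : v = 0 := (hs v).symm.trans ((hker _).1 hv)
      rw [h]
      exact map_zero s
    · rw [codisjoint_iff, Submodule.eq_top_iff']
      intro a
      refine Submodule.mem_sup.2 ⟨s (π a), hmem.2 ⟨_, rfl⟩, a - s (π a), ?_, add_sub_cancel _ _⟩
      change a - s (π a) ∈ J
      rw [hker, map_sub, hs, sub_self]
end

section
/- Let G be a group and let L be a finite-dimensional Lie algebra over a field F of characteristic 0, equipped with a G-grading L = ⊕_{g∈G} L^{(g)} (with ⁅L^{(g)}, L^{(h)}⁆ ⊆ L^{(gh)} for all g, h ∈ G). Then the solvable radical R of L (the largest solvable ideal) is a graded ideal: R = ⊕_{g∈G} (R ∩ L^{(g)}). -/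
open DirectSum in
/-- The images of the pieces of a direct sum decomposition under a surjective linear map whose
kernel is homogeneous form a direct sum decomposition of the codomain. -/
theorem isInternal_map_of_homogeneous_ker {R ι M N : Type*} [Ring R] [DecidableEq ι]
    [AddCommGroup M] [Module R M] [AddCommGroup N] [Module R N]
    (𝒜 : ι → Submodule R M) [Decomposition 𝒜] (f : M →ₗ[R] N) (hf : Function.Surjective f)
    (hker : ∀ x, f x = 0 → ∀ i, f (decompose 𝒜 x i) = 0) :
    IsInternal fun i ↦ (𝒜 i).map f := by
  rw [isInternal_submodule_iff_iSupIndep_and_iSup_eq_top]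
  constructor
  · rw [iSupIndep_iff_finsetSum_eq_zero_imp_eq_zero]
    intro s v hv hsum i hi
    choose! a ha hav using hv
    have hzero : f (∑ j ∈ s, a j) = 0 := by
      rw [map_sum, ← hsum]
      exact Finset.sum_congr rfl hav
    have hcomp : (decompose 𝒜 (∑ j ∈ s, a j) i : M) = a i := by
      rw [decompose_sum, DFinsupp.finsetSum_apply, AddSubmonoidClass.coe_finsetSum,
        Finset.sum_eq_single i]
      · exact decompose_of_mem_same 𝒜 (ha i hi)
      · exact fun j hj hji ↦ decompose_of_mem_ne 𝒜 (ha j hj) hji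
      · exact fun h ↦ absurd hi h
    rw [← hav i hi, ← hcomp]
    exact hker _ hzero i
  · rw [← Submodule.map_iSup, (Decomposition.isInternal 𝒜).submodule_iSup_eq_top,
      Submodule.map_top, LinearMap.range_eq_top.mpr hf]

namespace LieIdeal

open LieAlgebra

variable {R L L' : Type*} [CommRing R] [LieRing L] [LieAlgebra R L] [LieRing L'] [LieAlgebra R L']

theorem isSolvable_iff_exists_derivedSeriesOfIdeal_eq_bot (I : LieIdeal R L) :
    IsSolvable I ↔ ∃ k, derivedSeriesOfIdeal R L k I = ⊥ := by
  simp_rw [LieAlgebra.isSolvable_iff R, derivedSeries_eq_bot_iff]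

theorem derivedSeriesOfIdeal_map {f : L →ₗ⁅R⁆ L'} (hf : Function.Surjective f) (I : LieIdeal R L)
    (k : ℕ) : (derivedSeriesOfIdeal R L k I).map f = derivedSeriesOfIdeal R L' k (I.map f) := by
  induction k with
  | zero => simp
  | succ k ih => rw [derivedSeriesOfIdeal_succ, derivedSeriesOfIdeal_succ, map_bracket_eq f hf, ih]

theorem isSolvable_map {f : L →ₗ⁅R⁆ L'} (hf : Function.Surjective f) (I : LieIdeal R L)
    [IsSolvable I] : IsSolvable (I.map f) := by
  obtain ⟨k, hk⟩ := I.isSolvable_iff_exists_derivedSeriesOfIdeal_eq_bot.mp inferInstance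
  refine (isSolvable_iff_exists_derivedSeriesOfIdeal_eq_bot _).mpr ⟨k, ?_⟩
  rw [← derivedSeriesOfIdeal_map hf, hk, map_eq_bot_iff]
  exact bot_le

theorem isSolvable_comap {f : L →ₗ⁅R⁆ L'} (hf : Function.Surjective f) [IsSolvable f.ker]
    (J : LieIdeal R L') [IsSolvable J] : IsSolvable (J.comap f) := by
  obtain ⟨k, hk⟩ := J.isSolvable_iff_exists_derivedSeriesOfIdeal_eq_bot.mp inferInstance
  obtain ⟨l, hl⟩ := f.ker.isSolvable_iff_exists_derivedSeriesOfIdeal_eq_bot.mp inferInstance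
  refine (isSolvable_iff_exists_derivedSeriesOfIdeal_eq_bot _).mpr ⟨l + k, ?_⟩
  have hle : derivedSeriesOfIdeal R L k (J.comap f) ≤ f.ker := by
    rw [← map_eq_bot_iff, derivedSeriesOfIdeal_map hf, eq_bot_iff, ← hk]
    exact derivedSeriesOfIdeal_mono map_comap_le k
  rw [derivedSeriesOfIdeal_add, eq_bot_iff, ← hl]
  exact derivedSeriesOfIdeal_mono hle l

end LieIdeal

namespace LieAlgebra

open DirectSum

variable {F G L : Type*} [Field F] [Group G] [DecidableEq G] [LieRing L] [LieAlgebra F L]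
  [FiniteDimensional F L]

/-- Homogeneous elements of a group-graded Lie algebra are orthogonal with respect to the Killing
form unless their degrees are inverse to each other. -/
theorem killingForm_eq_zero_of_mem_of_mul_ne_one {𝒜 : G → Submodule F L}
    (hbracket : ∀ g h : G, ∀ x ∈ 𝒜 g, ∀ y ∈ 𝒜 h, ⁅x, y⁆ ∈ 𝒜 (g * h))
    (hdecomp : IsInternal 𝒜) {g h : G} (hgh : g * h ≠ 1) {x y : L} (hx : x ∈ 𝒜 g)
    (hy : y ∈ 𝒜 h) : killingForm F L x y = 0 := by
  rw [killingForm_apply_apply]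
  refine LinearMap.trace_eq_zero_of_mapsTo_ne hdecomp (fun k ↦ g * (h * k)) (fun k hk ↦ hgh ?_) ?_
  · rwa [← mul_assoc, mul_eq_right] at hk
  · exact fun k z hz ↦ hbracket _ _ _ hx _ (hbracket _ _ _ hy _ hz)

/-- The Killing radical of a group-graded Lie algebra is homogeneous. -/
theorem decompose_mem_killingCompl_top {𝒜 : G → Submodule F L} [Decomposition 𝒜]
    (hbracket : ∀ g h : G, ∀ x ∈ 𝒜 g, ∀ y ∈ 𝒜 h, ⁅x, y⁆ ∈ 𝒜 (g * h))
    {x : L} (hx : x ∈ LieIdeal.killingCompl F L ⊤) (g : G) :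
    (decompose 𝒜 x g : L) ∈ LieIdeal.killingCompl F L ⊤ := by
  classical
  have hdecomp := Decomposition.isInternal 𝒜
  rw [LieIdeal.mem_killingCompl] at hx ⊢
  rintro y -
  induction y using Decomposition.inductionOn 𝒜 with
  | zero => simp
  | add y z hy hz => rw [map_add, LinearMap.add_apply, hy, hz, add_zero]
  | @homogeneous h y =>
    by_cases hgh : h * g = 1
    · rw [← hx y (LieSubmodule.mem_top _)]
      conv_rhs => rw [← sum_support_decompose 𝒜 x]
      rw [map_sum, Finset.sum_eq_single g]
      · refine fun k _ hk ↦ killingForm_eq_zero_of_mem_of_mul_ne_one hbracket hdecomp (g := h)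
          (h := k) (fun hhk ↦ hk ?_) y.2 (SetLike.coe_mem _)
        exact mul_left_cancel (hhk.trans hgh.symm)
      · intro hg
        rw [DFinsupp.notMem_support_iff.mp hg]
        simp
    · exact killingForm_eq_zero_of_mem_of_mul_ne_one hbracket hdecomp hgh y.2 (SetLike.coe_mem _)

end LieAlgebra

/-- The largest graded ideal contained in an ideal of a graded Lie algebra. -/
def LieIdeal.gradedCore {R G L : Type*} [CommRing R] [Group G] [LieRing L] [LieAlgebra R L]
    (𝒜 : G → Submodule R L)
    (hbracket : ∀ g h : G, ∀ x ∈ 𝒜 g, ∀ y ∈ 𝒜 h, ⁅x, y⁆ ∈ 𝒜 (g * h))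
    (htop : ⨆ g, 𝒜 g = ⊤) (I : LieIdeal R L) : LieIdeal R L where
  toSubmodule := ⨆ g, LieSubmodule.toSubmodule I ⊓ 𝒜 g
  lie_mem {x m} hm := by
    change ⁅x, m⁆ ∈ ⨆ g, LieSubmodule.toSubmodule I ⊓ 𝒜 g
    replace hm : m ∈ ⨆ g, LieSubmodule.toSubmodule I ⊓ 𝒜 g := hm
    have hx : x ∈ ⨆ g, 𝒜 g := htop ▸ Submodule.mem_top
    induction hx using Submodule.iSup_induction' with
    | zero => simp
    | add y z _ _ hy hz => rw [add_lie]; exact add_mem hy hz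
    | mem h y hy =>
      induction hm using Submodule.iSup_induction' with
      | zero => simp
      | add m n _ _ hm hn => rw [lie_add]; exact add_mem hm hn
      | mem g m hm =>
        exact Submodule.mem_iSup_of_mem (h * g) ⟨I.lie_mem hm.1, hbracket h g y hy m hm.2⟩

/-- the solvable radical of a finite-dimensional Lie algebra over a field of
characteristic `0`, graded by an arbitrary group `G`, is a graded ideal. -/
theorem stmt10 {F : Type*} [Field F] [CharZero F] {G : Type*} [Group G] [DecidableEq G]
    {L : Type*} [LieRing L] [LieAlgebra F L] [FiniteDimensional F L]
    (𝒜 : G → Submodule F L)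
    (hbracket : ∀ g h : G, ∀ x ∈ 𝒜 g, ∀ y ∈ 𝒜 h, ⁅x, y⁆ ∈ 𝒜 (g * h))
    (hdecomp : DirectSum.IsInternal 𝒜) :
    LieSubmodule.toSubmodule (LieAlgebra.radical F L)
      = ⨆ g : G, LieSubmodule.toSubmodule (LieAlgebra.radical F L) ⊓ 𝒜 g := by
  let _ := hdecomp.chooseDecomposition
  set I := LieAlgebra.radical F L
  have hle : ⨆ g : G, LieSubmodule.toSubmodule I ⊓ 𝒜 g ≤ LieSubmodule.toSubmodule I :=
    iSup_le fun _ ↦ inf_le_left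
  refine le_antisymm ?_ hle
  let J := I.gradedCore 𝒜 hbracket hdecomp.submodule_iSup_eq_top
  have hJI : J ≤ I := hle
  let π : L →ₗ⁅F⁆ L ⧸ J := { J.toSubmodule.mkQ with map_lie' := rfl }
  have hπ : Function.Surjective π := J.toSubmodule.mkQ_surjective
  have hπJ (x : L) : π x = 0 ↔ x ∈ J := Submodule.Quotient.mk_eq_zero J.toSubmodule
  have hker : π.ker = J := by ext x; exact LieHom.mem_ker.trans (hπJ x)
  have hJ_hom (x : L) (hx : x ∈ J) (g : G) : (DirectSum.decompose 𝒜 x g : L) ∈ J := by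
    replace hx : x ∈ ⨆ g, LieSubmodule.toSubmodule I ⊓ 𝒜 g := hx
    induction hx using Submodule.iSup_induction' with
    | zero => simp
    | add y z _ _ hy hz => simpa using add_mem hy hz
    | mem h y hy =>
      obtain rfl | hne := eq_or_ne h g
      · rw [DirectSum.decompose_of_mem_same 𝒜 hy.2]
        exact Submodule.mem_iSup_of_mem h hy
      · rw [DirectSum.decompose_of_mem_ne 𝒜 hy.2 hne]
        exact zero_mem J
  have hdecomp' : DirectSum.IsInternal fun g ↦ (𝒜 g).map (π : L →ₗ[F] L ⧸ J) :=
    isInternal_map_of_homogeneous_ker 𝒜 (π : L →ₗ[F] L ⧸ J) hπ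
      fun x hx g ↦ (hπJ _).mpr (hJ_hom x ((hπJ x).mp hx) g)
  have hbracket' (g h : G) : ∀ x ∈ (𝒜 g).map (π : L →ₗ[F] L ⧸ J),
      ∀ y ∈ (𝒜 h).map (π : L →ₗ[F] L ⧸ J), ⁅x, y⁆ ∈ (𝒜 (g * h)).map (π : L →ₗ[F] L ⧸ J) := by
    rintro - ⟨x, hx, rfl⟩ - ⟨y, hy, rfl⟩
    exact ⟨⁅x, y⁆, hbracket g h x hx y hy, π.map_lie x y⟩
  let _ := hdecomp'.chooseDecomposition
  have : FiniteDimensional F (L ⧸ J) := Module.Finite.of_surjective (π : L →ₗ[F] L ⧸ J) hπ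
  have : LieAlgebra.IsSolvable π.ker := by
    rw [hker]
    exact (LieAlgebra.LieIdeal.solvable_iff_le_radical F L J).mpr hJI
  have hcomap : (LieAlgebra.radical F (L ⧸ J)).comap π ≤ I :=
    (LieAlgebra.LieIdeal.solvable_iff_le_radical F L _).mp (LieIdeal.isSolvable_comap hπ _)
  have : LieAlgebra.IsKilling F (L ⧸ J) := by
    classical
    refine ⟨(LieSubmodule.eq_bot_iff _).mpr fun x hx ↦ ?_⟩
    rw [← DirectSum.sum_support_decompose (fun g ↦ (𝒜 g).map (π : L →ₗ[F] L ⧸ J)) x]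
    refine Finset.sum_eq_zero fun g _ ↦ ?_
    have hxg := LieAlgebra.killingCompl_top_le_radical F (L ⧸ J)
      (LieAlgebra.decompose_mem_killingCompl_top hbracket' hx g)
    obtain ⟨y, hy, hyx⟩ := (DirectSum.decompose (fun g ↦ (𝒜 g).map (π : L →ₗ[F] L ⧸ J)) x g).2
    rw [← hyx] at hxg ⊢
    exact (hπJ y).mpr (Submodule.mem_iSup_of_mem g ⟨hcomap hxg, hy⟩)
  intro x hx
  refine (hπJ x).mp ?_
  have hmap := (LieAlgebra.LieIdeal.solvable_iff_le_radical F (L ⧸ J) _).mp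
    (LieIdeal.isSolvable_map hπ I)
  rw [LieAlgebra.HasTrivialRadical.radical_eq_bot] at hmap
  exact (LieSubmodule.mem_bot _).mp (hmap (LieIdeal.mem_map hx))
end

section
/- Let G be a group and let L be a finite-dimensional Lie algebra over a field F of characteristic 0, equipped with a G-grading L = ⊕_{g∈G} L^{(g)} (with ⁅L^{(g)}, L^{(h)}⁆ ⊆ L^{(gh)} for all g, h ∈ G), and let R denote the solvable radical of L. Then there exists a Lie subalgebra B ⊆ L such that B is a graded subspace (B = ⊕_{g∈G} (B ∩ L^{(g)})), B is a semisimple Lie algebra, and L = B ⊕ R as F-vector spaces (internal direct sum). -/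
open LieModule in
/-- The radical of the trace form of an irreducible module brackets into the annihilator. -/
theorem LieModule.lie_lie_eq_zero_of_traceForm_eq_zero
    {F S V : Type*} [Field F] [CharZero F] [LieRing S] [LieAlgebra F S]
    [AddCommGroup V] [Module F V] [FiniteDimensional F V] [LieRingModule S V] [LieModule F S V]
    [LieModule.IsIrreducible F S V] {x y : S} (hx : ∀ s, traceForm F S V s x = 0)
    (hy : ∀ s, traceForm F S V s y = 0) (v : V) : ⁅⁅x, y⁆, v⁆ = 0 := by
  let Q : LieIdeal F S := LieAlgebra.InvariantForm.orthogonal (traceForm F S V)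
    (traceForm_lieInvariant F S V) ⊤
  have hQ {z : S} : z ∈ Q ↔ ∀ s, traceForm F S V s z = 0 := by
    simp [Q, LieAlgebra.InvariantForm.mem_orthogonal]
  have h0 : traceForm F Q V = 0 := by
    ext a b
    exact hQ.1 b.2 a
  have hnil := isNilpotent_derivedSeries_of_traceForm_eq_zero h0
  have : Nontrivial V := nontrivial_of_isIrreducible F S V
  have hnt := nontrivial_max_triv_of_isNilpotent F (LieAlgebra.derivedSeries F Q 1) V
  have hD {a b : S} (ha : a ∈ Q) (hb : b ∈ Q) :
      ⁅(⟨a, ha⟩ : Q), (⟨b, hb⟩ : Q)⁆ ∈ LieAlgebra.derivedSeries F Q 1 :=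
    LieSubmodule.lie_mem_lie (LieSubmodule.mem_top _) (LieSubmodule.mem_top _)
  let T : LieSubmodule F S V :=
    { carrier := {w | ∀ a ∈ Q, ∀ b ∈ Q, ⁅⁅a, b⁆, w⁆ = 0}
      add_mem' := fun h₁ h₂ a ha b hb => by rw [lie_add, h₁ a ha b hb, h₂ a ha b hb, add_zero]
      zero_mem' := fun a _ b _ => lie_zero _
      smul_mem' := fun c w h a ha b hb => by rw [lie_smul, h a ha b hb, smul_zero]
      lie_mem := by
        intro z w h a ha b hb
        have h1 := h _ (lie_mem_right F S Q z a ha) b hb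
        have h2 := h a ha _ (lie_mem_right F S Q z b hb)
        rw [leibniz_lie, h a ha b hb, lie_zero, add_zero, ← lie_skew, leibniz_lie z a b,
          neg_lie, add_lie, h1, h2, add_zero, neg_zero] }
  have hT : Nontrivial T := by
    obtain ⟨w, hw⟩ := exists_ne (0 : maxTrivSubmodule F (LieAlgebra.derivedSeries F Q 1) V)
    refine ⟨⟨⟨w, fun a ha b hb => ?_⟩, 0, fun h => hw ?_⟩⟩
    · exact w.2 ⟨_, hD ha hb⟩
    · exact Subtype.ext (congrArg (Subtype.val : T → V) h)
  have hv : v ∈ T := by rw [LieSubmodule.eq_top_of_isIrreducible F S V T]; trivial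
  exact hv x (hQ.2 hx) y (hQ.2 hy)

section Casimir

open LieModule TensorProduct

variable {F S V : Type*} [Field F] [LieRing S] [LieAlgebra F S] [FiniteDimensional F S]
  [AddCommGroup V] [Module F V] [LieRingModule S V] [LieModule F S V]

/-- Dual bases of an ideal with respect to an invariant form give an invariant tensor. -/
theorem LieAlgebra.exists_casimirTensor (B : LinearMap.BilinForm F S) (hsymm : B.IsSymm)
    (hinv : ∀ x y z : S, B ⁅x, y⁆ z = -B y ⁅x, z⁆) (I : LieIdeal F S)
    (hI : (B.restrict I.toSubmodule).Nondegenerate) :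
    ∃ u v : Fin (Module.finrank F I) → S,
      (∀ x : S, ∑ i, (⁅x, u i⁆ ⊗ₜ[F] v i + u i ⊗ₜ[F] ⁅x, v i⁆) = 0) ∧
      ∀ i, B (u i) (v i) = 1 := by
  set B' := B.restrict I.toSubmodule with hB'
  have hs : B'.IsSymm := ⟨fun x y => hsymm.eq _ _⟩
  let b : Module.Basis (Fin (Module.finrank F I)) F I.toSubmodule := Module.finBasis F I
  let b' := B'.dualBasis hI b
  have hb (y : I) : (y : S) = ∑ j, B y (b' j) • (b j : S) := by
    have h1 : B'.dualBasis hI b' = b := LinearMap.BilinForm.dualBasis_dualBasis hI hs b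
    have h2 := congrArg Subtype.val (b.sum_repr y)
    conv_lhs => rw [← h2]
    simp only [AddSubmonoidClass.coe_finsetSum, SetLike.val_smul]
    refine Finset.sum_congr rfl fun j _ => ?_
    congr 1
    have h3 := LinearMap.BilinForm.dualBasis_repr_apply hI b' y j
    rw [h1] at h3
    exact h3
  have hb' (y : I) : (y : S) = ∑ j, B y (b j) • (b' j : S) := by
    have h2 := congrArg Subtype.val (b'.sum_repr y)
    conv_lhs => rw [← h2]
    simp only [AddSubmonoidClass.coe_finsetSum, SetLike.val_smul]
    refine Finset.sum_congr rfl fun j _ => ?_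
    congr 1
    exact LinearMap.BilinForm.dualBasis_repr_apply hI b y j
  refine ⟨fun i => b i, fun i => b' i, fun x => ?_, fun i => ?_⟩
  · have h1 (i) : ⁅x, (b i : S)⁆ ⊗ₜ[F] (b' i : S) =
        ∑ j, B ⁅x, (b i : S)⁆ (b' j) • ((b j : S) ⊗ₜ[F] (b' i : S)) := by
      have h := hb ⟨_, lie_mem_right F S I x _ (b i).2⟩
      dsimp only at h
      conv_lhs => rw [h]
      simp only [TensorProduct.sum_tmul, TensorProduct.smul_tmul']
    have h2 (i) : (b i : S) ⊗ₜ[F] ⁅x, (b' i : S)⁆ =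
        ∑ j, B ⁅x, (b' i : S)⁆ (b j) • ((b i : S) ⊗ₜ[F] (b' j : S)) := by
      have h := hb' ⟨_, lie_mem_right F S I x _ (b' i).2⟩
      dsimp only at h
      conv_lhs => rw [h]
      simp only [TensorProduct.tmul_sum, TensorProduct.tmul_smul]
    simp only [Finset.sum_add_distrib, h1, h2]
    rw [Finset.sum_comm, ← Finset.sum_add_distrib]
    refine Finset.sum_eq_zero fun i _ => ?_
    rw [← Finset.sum_add_distrib]
    refine Finset.sum_eq_zero fun j _ => ?_
    rw [← add_smul, hinv, ← hsymm.eq ⁅x, (b' i : S)⁆]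
    simp
  · exact (LinearMap.BilinForm.apply_dualBasis_right hI hs b i i).trans (if_pos rfl)

variable [CharZero F] [LieAlgebra.IsKilling F S] [FiniteDimensional F V]

theorem LieModule.exists_casimir [LieModule.IsIrreducible F S V] (hV : ¬ LieModule.IsTrivial S V) :
    ∃ (n : ℕ) (u v : Fin n → S),
      (∀ x : S, ∑ i, (⁅x, u i⁆ ⊗ₜ[F] v i + u i ⊗ₜ[F] ⁅x, v i⁆) = 0) ∧
      (∀ x : S, ∀ w : V, ∑ i, ⁅u i, ⁅v i, ⁅x, w⁆⁆⁆ = ⁅x, ∑ i, ⁅u i, ⁅v i, w⁆⁆⁆) ∧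
      ∃ c : V ≃ₗ[F] V, ∀ w, c w = ∑ i, ⁅u i, ⁅v i, w⁆⁆ := by
  let N : LieIdeal F S := LieModule.ker F S V
  let I := N.killingCompl
  have hNI : IsCompl N I := N.isCompl_killingCompl
  have hNt (x : S) (hx : x ∈ N) : traceForm F S V x = 0 := by
    ext y
    rw [LieModule.mem_ker] at hx
    have : toEnd F S V x = 0 := by ext w; exact hx w
    rw [traceForm_apply_apply, this]; simp
  have key (x : S) (hxI : x ∈ I) (hx : ∀ y ∈ I, traceForm F S V y x = 0) : x = 0 := by
    let Q : LieIdeal F S := I ⊓ LieAlgebra.InvariantForm.orthogonal (traceForm F S V)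
      (traceForm_lieInvariant F S V) ⊤
    have hQ {z : S} : z ∈ Q ↔ z ∈ I ∧ ∀ s, traceForm F S V s z = 0 := by
      simp [Q, LieAlgebra.InvariantForm.mem_orthogonal]
    have hab : IsLieAbelian Q := by
      rw [LieSubmodule.lie_abelian_iff_lie_self_eq_bot, LieSubmodule.lie_eq_bot_iff]
      intro a ha b hb
      have h1 : ⁅a, b⁆ ∈ N ⊓ I := by
        refine ⟨?_, lie_mem_right F S I a b (hQ.1 hb).1⟩
        exact (LieModule.mem_ker F S V _).2
          (lie_lie_eq_zero_of_traceForm_eq_zero (F := F) (hQ.1 ha).2 (hQ.1 hb).2)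
      rwa [hNI.inf_eq_bot, LieSubmodule.mem_bot] at h1
    have hbot : Q = ⊥ := LieAlgebra.IsKilling.ideal_eq_bot_of_isLieAbelian Q
    have : x ∈ Q := by
      refine hQ.2 ⟨hxI, fun s => ?_⟩
      have hs : s ∈ N ⊔ I := by rw [hNI.sup_eq_top]; trivial
      obtain ⟨n, hn, i, hi, rfl⟩ := LieSubmodule.mem_sup _ _ _ |>.1 hs
      rw [map_add, LinearMap.add_apply, hNt n hn, hx i hi]; simp
    rwa [hbot, LieSubmodule.mem_bot] at this
  have hI : ((traceForm F S V).restrict I.toSubmodule).Nondegenerate := by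
    refine ⟨fun x hx => Subtype.ext (key x x.2 fun y hy => ?_),
      fun x hx => Subtype.ext (key x x.2 fun y hy => hx ⟨y, hy⟩)⟩
    rw [traceForm_comm]
    exact hx ⟨y, hy⟩
  have hI0 : Module.finrank F I ≠ 0 := by
    intro h
    have h1 : I = ⊥ := by
      rw [← LieSubmodule.toSubmodule_eq_bot]
      exact Submodule.finrank_eq_zero.1 h
    have h2 := hNI.sup_eq_top
    rw [h1, sup_bot_eq] at h2
    refine hV ⟨fun x w => ?_⟩
    have : x ∈ N := by rw [h2]; trivial
    exact (LieModule.mem_ker F S V _).1 this w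
  obtain ⟨u, v, huv, h1⟩ := LieAlgebra.exists_casimirTensor (traceForm F S V)
    ⟨traceForm_comm F S V⟩ (fun x y z => by
      rw [← lie_skew, map_neg, LinearMap.neg_apply, traceForm_apply_lie_apply]) I hI
  let c := ∑ i, toEnd F S V (u i) * toEnd F S V (v i)
  have hc (w : V) : c w = ∑ i, ⁅u i, ⁅v i, w⁆⁆ := by simp [c]
  have hcomm (x : S) (w : V) : c ⁅x, w⁆ = ⁅x, c w⁆ := by
    have h2 := congrArg (TensorProduct.lift
      ((LinearMap.mul F (Module.End F V)).compl₁₂ (toEnd F S V : S →ₗ[F] _)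
        (toEnd F S V : S →ₗ[F] _))) (huv x)
    have h3 := LinearMap.congr_fun h2 w
    simp only [map_sum, map_add, TensorProduct.lift.tmul, LinearMap.compl₁₂_apply,
      LieHom.coe_toLinearMap, LinearMap.mul_apply', LinearMap.sum_apply, LinearMap.add_apply,
      Module.End.mul_apply, toEnd_apply_apply, map_zero, LinearMap.zero_apply, lie_lie,
      lie_sub, sub_add_sub_cancel] at h3
    rw [hc, hc, lie_sum]
    rw [Finset.sum_sub_distrib, sub_eq_zero] at h3
    exact h3.symm
  have hc0 : c ≠ 0 := by
    intro h
    have h2 : LinearMap.trace F V c = Module.finrank F I := by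
      have h3 (i) : LinearMap.trace F V (toEnd F S V (u i) * toEnd F S V (v i)) = 1 := h1 i
      simp only [c, map_sum]
      simp [h3]
    rw [h, map_zero] at h2
    exact hI0 (by exact_mod_cast h2.symm)
  let T : LieSubmodule F S V :=
    { LinearMap.ker c with
      lie_mem := fun {x w} hw => by
        have hw' : c w = 0 := hw
        change c ⁅x, w⁆ = 0
        rw [hcomm, hw', lie_zero] }
  have hinj : Function.Injective c := by
    rw [← LinearMap.ker_eq_bot]
    rcases IsSimpleOrder.eq_bot_or_eq_top T with h | h
    · rw [← LieSubmodule.toSubmodule_eq_bot] at h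
      exact h
    · refine absurd (LinearMap.ext fun w => ?_) hc0
      have : w ∈ T := by rw [h]; trivial
      exact this
  exact ⟨_, u, v, huv, fun x w => by rw [← hc, ← hc, hcomm],
    LinearEquiv.ofInjectiveEndo c hinj, fun w => hc w⟩

end Casimir

section Whitehead

open LieModule TensorProduct

variable {F S V : Type*} [Field F] [LieRing S] [LieAlgebra F S]
  [FiniteDimensional F S] [LieAlgebra.IsKilling F S]
  [AddCommGroup V] [Module F V] [FiniteDimensional F V] [LieRingModule S V]

/-- Whitehead's second lemma for a trivial module. -/
theorem LieModule.exists_coboundary_of_isTrivial [LieModule.IsTrivial S V]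
    (ω : S →ₗ[F] S →ₗ[F] V) (halt : ∀ x y, ω x y = -ω y x)
    (hω : ∀ x y z, ⁅x, ω y z⁆ - ⁅y, ω x z⁆ + ⁅z, ω x y⁆ - ω ⁅x, y⁆ z + ω ⁅x, z⁆ y
      - ω ⁅y, z⁆ x = 0) :
    ∃ φ : S →ₗ[F] V, ∀ x y, ω x y = ⁅x, φ y⁆ - ⁅y, φ x⁆ - φ ⁅x, y⁆ := by
  simp only [trivial_lie_zero, sub_zero, zero_sub, add_zero] at hω ⊢
  have hnd : (killingForm F S).Nondegenerate := LieAlgebra.IsKilling.killingForm_nondegenerate F S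
  have key (θ : S →ₗ[F] S →ₗ[F] F) (halt : ∀ x y, θ x y = -θ y x)
      (hθ : ∀ x y z, -θ ⁅x, y⁆ z + θ ⁅x, z⁆ y - θ ⁅y, z⁆ x = 0) :
      ∃ φ : S →ₗ[F] F, ∀ x y, θ x y = -φ ⁅x, y⁆ := by
    let D : S →ₗ[F] S := (LinearMap.BilinForm.toDual (killingForm F S) hnd).symm.toLinearMap ∘ₗ θ
    have hD (x y : S) : killingForm F S (D x) y = θ x y := by
      simp [D]
    let D' : LieDerivation F S S :=
      { D with
        leibniz' := fun a b => by
          refine sub_eq_zero.1 (hnd.1 _ fun c => ?_)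
          have h := hθ a b c
          change killingForm F S (D ⁅a, b⁆ - (⁅a, D b⁆ - ⁅b, D a⁆)) c = 0
          rw [← lie_skew a (D b), ← lie_skew b (D a)]
          simp only [map_sub, map_neg, LinearMap.sub_apply, LinearMap.neg_apply,
            LieModule.traceForm_apply_lie_apply, hD]
          linear_combination -h + halt b ⁅a, c⁆ - halt a ⁅b, c⁆ }
    obtain ⟨z, hz⟩ := LieDerivation.IsKilling.exists_eq_ad D'
    refine ⟨-killingForm F S z, fun x y => ?_⟩
    have h1 : D x = ⁅z, x⁆ := by
      have h2 := LieDerivation.congr_fun hz x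
      rw [LieDerivation.ad_apply_apply] at h2
      exact h2.symm
    rw [← hD, h1, LieModule.traceForm_apply_lie_apply, LinearMap.neg_apply, neg_neg]
  let b := Module.finBasis F V
  choose φ hφ using fun i => key (ω.compr₂ (b.coord i))
    (fun x y => by
      simp only [LinearMap.compr₂_apply]
      rw [halt, map_neg])
    (fun x y z => by
      simp only [LinearMap.compr₂_apply]
      rw [← map_neg, ← map_add, ← map_sub, hω, map_zero])
  refine ⟨∑ i, (φ i).smulRight (b i), fun x y => b.ext_elem fun i => ?_⟩
  have h := hφ i x y
  simp only [LinearMap.compr₂_apply, Module.Basis.coord_apply] at h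
  rw [h]
  simp [Finsupp.single_apply]

variable [CharZero F] [LieModule F S V]

/-- Whitehead's second lemma for a nontrivial irreducible module. -/
theorem LieModule.exists_coboundary_of_not_isTrivial [LieModule.IsIrreducible F S V]
    (hV : ¬ LieModule.IsTrivial S V) (ω : S →ₗ[F] S →ₗ[F] V) (halt : ∀ x y, ω x y = -ω y x)
    (hω : ∀ x y z, ⁅x, ω y z⁆ - ⁅y, ω x z⁆ + ⁅z, ω x y⁆ - ω ⁅x, y⁆ z + ω ⁅x, z⁆ y
      - ω ⁅y, z⁆ x = 0) :
    ∃ φ : S →ₗ[F] V, ∀ x y, ω x y = ⁅x, φ y⁆ - ⁅y, φ x⁆ - φ ⁅x, y⁆ := by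
  obtain ⟨n, u, v, huv, hcomm, c, hc⟩ := exists_casimir (F := F) hV
  let φ₀ : S →ₗ[F] V := ∑ i, (toEnd F S V (u i)) ∘ₗ (ω.flip (v i))
  have hφ₀ (x : S) : φ₀ x = ∑ i, ⁅u i, ω x (v i)⁆ := by simp [φ₀]
  have hinv (x y : S) : ∑ i, (⁅⁅x, u i⁆, ω y (v i)⁆ + ⁅u i, ω y ⁅x, v i⁆⁆) = 0 := by
    let A : S →ₗ[F] V →ₗ[F] V := (toEnd F S V : S →ₗ[F] Module.End F V)
    have h := congrArg (TensorProduct.lift (A.compl₂ (ω y))) (huv x)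
    simpa [A] using h
  have hcφ (x y : S) : ⁅x, φ₀ y⁆ - ⁅y, φ₀ x⁆ - φ₀ ⁅x, y⁆ = -c (ω x y) := by
    have h1 (x y : S) : ⁅x, φ₀ y⁆ = ∑ i, (⁅u i, ⁅x, ω y (v i)⁆⁆ - ⁅u i, ω y ⁅x, v i⁆⁆) := by
      rw [hφ₀, lie_sum, ← sub_zero (∑ i, _), ← hinv x y, ← Finset.sum_sub_distrib]
      refine Finset.sum_congr rfl fun i _ => ?_
      rw [leibniz_lie]
      abel
    rw [h1, h1, hφ₀, hc, ← Finset.sum_sub_distrib, ← Finset.sum_sub_distrib,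
      ← Finset.sum_neg_distrib]
    refine Finset.sum_congr rfl fun i _ => ?_
    simp only [← lie_sub, ← lie_neg]
    congr 1
    rw [← sub_eq_zero, ← hω x y (v i), halt ⁅x, v i⁆ y, halt ⁅y, v i⁆ x,
      lie_neg]
    abel
  have hcs (x : S) (w : V) : c.symm ⁅x, w⁆ = ⁅x, c.symm w⁆ := by
    rw [LinearEquiv.symm_apply_eq, hc, hcomm, ← hc, LinearEquiv.apply_symm_apply]
  refine ⟨-(c.symm.toLinearMap ∘ₗ φ₀), fun x y => ?_⟩
  have h := congrArg c.symm (hcφ x y)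
  simp only [map_sub, map_neg, hcs, LinearEquiv.symm_apply_apply] at h
  simp only [LinearMap.neg_apply, LinearMap.comp_apply, LinearEquiv.coe_coe, lie_neg]
  rw [← neg_eq_iff_eq_neg.2 h]
  abel

/-- Whitehead's second lemma for an irreducible module. -/
theorem LieModule.exists_coboundary [LieModule.IsIrreducible F S V]
    (ω : S →ₗ[F] S →ₗ[F] V) (halt : ∀ x y, ω x y = -ω y x)
    (hω : ∀ x y z, ⁅x, ω y z⁆ - ⁅y, ω x z⁆ + ⁅z, ω x y⁆ - ω ⁅x, y⁆ z + ω ⁅x, z⁆ y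
      - ω ⁅y, z⁆ x = 0) :
    ∃ φ : S →ₗ[F] V, ∀ x y, ω x y = ⁅x, φ y⁆ - ⁅y, φ x⁆ - φ ⁅x, y⁆ := by
  by_cases hV : LieModule.IsTrivial S V
  · exact exists_coboundary_of_isTrivial ω halt hω
  · exact exists_coboundary_of_not_isTrivial hV ω halt hω

end Whitehead

section Solvable

open LieAlgebra

variable {F L L' : Type*} [Field F] [LieRing L] [LieAlgebra F L] [LieRing L'] [LieAlgebra F L']

/-- An extension of a solvable Lie algebra by a solvable Lie algebra is solvable. -/
theorem LieHom.isSolvable_of_ker (f : L →ₗ⁅F⁆ L') [IsSolvable L'] [IsSolvable f.ker] :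
    IsSolvable L := by
  obtain ⟨k, hk⟩ := IsSolvable.solvable F L'
  obtain ⟨l, hl⟩ := IsSolvable.solvable F f.ker
  refine IsSolvable.mk (R := F) (k := l + k) ?_
  have h1 : derivedSeries F L k ≤ f.ker := by
    intro x hx
    have h2 := LieIdeal.derivedSeries_map_le (f := f) k (LieIdeal.mem_map hx)
    rw [hk, LieSubmodule.mem_bot] at h2
    exact LieHom.mem_ker.2 h2
  rw [LieIdeal.derivedSeries_eq_bot_iff] at hl
  rw [derivedSeries_def, derivedSeriesOfIdeal_add, eq_bot_iff, ← hl]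
  exact derivedSeriesOfIdeal_mono h1 l

theorem LieIdeal.isSolvable_comap_s12 (f : L →ₗ⁅F⁆ L') [IsSolvable f.ker] (J : LieIdeal F L')
    [IsSolvable J] : IsSolvable (J.comap f) := by
  let g : J.comap f →ₗ⁅F⁆ J :=
    { (f : L →ₗ[F] L').restrict (p := (J.comap f).toSubmodule) (q := J.toSubmodule)
        fun x hx => LieIdeal.mem_comap.1 hx with
      map_lie' := fun {x y} => Subtype.ext (f.map_lie x y) }
  let h : g.ker →ₗ⁅F⁆ f.ker :=
    { toFun := fun x => ⟨x.1.1, LieHom.mem_ker.2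
        (congrArg Subtype.val (LieHom.mem_ker.1 x.2))⟩
      map_add' := fun _ _ => rfl
      map_smul' := fun _ _ => rfl
      map_lie' := rfl }
  have : IsSolvable g.ker := Function.Injective.lieAlgebra_isSolvable (f := h)
    fun x y hxy => Subtype.ext (Subtype.ext (congrArg (Subtype.val : f.ker → L) hxy))
  exact g.isSolvable_of_ker

theorem LieIdeal.eq_bot_of_lie_self_eq (I : LieIdeal F L) [IsSolvable I] (h : ⁅I, I⁆ = I) :
    I = ⊥ := by
  obtain ⟨k, hk⟩ := IsSolvable.solvable F I
  rw [LieIdeal.derivedSeries_eq_bot_iff] at hk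
  rw [← hk]
  clear hk
  induction k with
  | zero => rfl
  | succ k ih => rw [derivedSeriesOfIdeal_succ, ← ih, h]

/-- The quotient map by an ideal, as a morphism of Lie algebras. -/
def LieIdeal.quotientHom (I : LieIdeal F L) : L →ₗ⁅F⁆ L ⧸ I :=
  { (LieSubmodule.Quotient.mk' I : L →ₗ[F] L ⧸ I) with
    map_lie' := fun {x y} => LieSubmodule.Quotient.mk_bracket I x y }

theorem LieIdeal.quotientHom_surjective (I : LieIdeal F L) :
    Function.Surjective I.quotientHom :=
  LieSubmodule.Quotient.surjective_mk' I

theorem LieIdeal.quotientHom_eq_zero {I : LieIdeal F L} {x : L} : I.quotientHom x = 0 ↔ x ∈ I :=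
  LieSubmodule.Quotient.mk_eq_zero I

theorem LieIdeal.ker_quotientHom (I : LieIdeal F L) : I.quotientHom.ker = I := by
  ext x
  rw [LieHom.mem_ker, quotientHom_eq_zero]

/-- A Lie algebra morphism vanishing on an ideal descends to the quotient. -/
def LieIdeal.quotientLift (I : LieIdeal F L) (f : L →ₗ⁅F⁆ L') (h : I ≤ f.ker) :
    L ⧸ I →ₗ⁅F⁆ L' :=
  { Submodule.liftQ I.toSubmodule (f : L →ₗ[F] L') fun _ hx => LieHom.mem_ker.1 (h hx) with
    map_lie' := fun {x y} => by
      obtain ⟨x, rfl⟩ := I.quotientHom_surjective x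
      obtain ⟨y, rfl⟩ := I.quotientHom_surjective y
      exact f.map_lie x y }

end Solvable

section Splitting

open LieAlgebra Module

variable {F S : Type*} [Field F] [CharZero F] [LieRing S] [LieAlgebra F S]
  [FiniteDimensional F S] [IsKilling F S]

theorem LieHom.exists_section_of_isAtom_ker {L : Type*} [LieRing L] [LieAlgebra F L]
    [FiniteDimensional F L] (f : L →ₗ⁅F⁆ S) (hf : Function.Surjective f)
    (hab : ∀ a ∈ f.ker, ∀ b ∈ f.ker, ⁅a, b⁆ = 0) (hmin : IsAtom f.ker) :
    ∃ s : S →ₗ⁅F⁆ L, ∀ x, f (s x) = x := by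
  obtain ⟨σ, hσ⟩ := (f : L →ₗ[F] S).exists_rightInverse_of_surjective (LinearMap.range_eq_top.2 hf)
  replace hσ (x : S) : f (σ x) = x := LinearMap.congr_fun hσ x
  have hact (x : L) (k : f.ker) : ⁅σ (f x), (k : L)⁆ = ⁅x, (k : L)⁆ := by
    rw [← sub_eq_zero, ← sub_lie]
    refine hab _ (LieHom.mem_ker.2 ?_) _ k.2
    rw [map_sub, hσ, sub_self]
  let _ : LieRingModule S f.ker :=
    { bracket := fun x k => ⁅σ x, k⁆
      add_lie := fun x y k => by
        change ⁅σ (x + y), k⁆ = ⁅σ x, k⁆ + ⁅σ y, k⁆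
        rw [map_add, add_lie]
      lie_add := fun x k l => lie_add (σ x) k l
      leibniz_lie := fun x y k => by
        change ⁅σ x, ⁅σ y, k⁆⁆ = ⁅σ ⁅x, y⁆, k⁆ + ⁅σ y, ⁅σ x, k⁆⁆
        rw [leibniz_lie]
        congr 1
        refine Subtype.ext ?_
        have h := hact ⁅σ x, σ y⁆ k
        rw [f.map_lie, hσ, hσ] at h
        exact h.symm }
  have hbr (x : S) (k : f.ker) : ((⁅x, k⁆ : f.ker) : L) = ⁅σ x, (k : L)⁆ := rfl
  let _ : LieModule F S f.ker :=
    { smul_lie := fun t x k => Subtype.ext (by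
        rw [hbr, map_smul, smul_lie]; rfl)
      lie_smul := fun t x k => Subtype.ext (by
        rw [hbr]; exact lie_smul t (σ x) (k : L)) }
  have : Nontrivial f.ker := (LieSubmodule.nontrivial_iff_ne_bot F L L).2 hmin.1
  have : LieModule.IsIrreducible F S f.ker := by
    refine LieModule.IsIrreducible.mk fun N hN => ?_
    let W : LieIdeal F L :=
      { N.toSubmodule.map f.ker.toSubmodule.subtype with
        lie_mem := by
          rintro x _ ⟨k, hk, rfl⟩
          exact ⟨_, N.lie_mem (x := f x) hk, hact x k⟩ }
    have hW {x : L} : x ∈ W ↔ ∃ k ∈ N, (k : L) = x := Iff.rfl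
    have hWK : W ≤ f.ker := by
      rintro _ ⟨k, hk, rfl⟩
      exact k.2
    rcases hmin.le_iff.1 hWK with h | h
    · refine absurd ((LieSubmodule.eq_bot_iff _).2 fun k hk => Subtype.ext ?_) hN
      have h1 : (k : L) ∈ W := ⟨k, hk, rfl⟩
      rwa [h, LieSubmodule.mem_bot] at h1
    · refine eq_top_iff.2 fun k _ => ?_
      have h1 : (k : L) ∈ W := by rw [h]; exact k.2
      obtain ⟨l, hl, h2⟩ := hW.1 h1
      rwa [Subtype.ext h2] at hl
  let ω : S →ₗ[F] S →ₗ[F] f.ker := LinearMap.mk₂ F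
    (fun x y => ⟨⁅σ x, σ y⁆ - σ ⁅x, y⁆, LieHom.mem_ker.2 (by
      rw [map_sub, f.map_lie, hσ, hσ, hσ, sub_self])⟩)
    (fun x y z => Subtype.ext (by
      simp only [map_add, add_lie, LieSubmodule.coe_add]; abel))
    (fun t x y => Subtype.ext (by
      simp only [map_smul, smul_lie, LieSubmodule.coe_smul, smul_sub]))
    (fun x y z => Subtype.ext (by
      simp only [map_add, lie_add, LieSubmodule.coe_add]; abel))
    (fun t x y => Subtype.ext (by
      simp only [map_smul, lie_smul, LieSubmodule.coe_smul, smul_sub]))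
  have hω (x y : S) : (ω x y : L) = ⁅σ x, σ y⁆ - σ ⁅x, y⁆ := rfl
  obtain ⟨φ, hφ⟩ := LieModule.exists_coboundary ω
    (fun x y => Subtype.ext (by
      rw [LieSubmodule.coe_neg, hω, hω, ← lie_skew (σ x), ← lie_skew x y, map_neg]; abel))
    (fun x y z => Subtype.ext (by
      have h1 := lie_jacobi (σ x) (σ y) (σ z)
      have h2 := congrArg σ (lie_jacobi x y z)
      simp only [LieSubmodule.coe_add, LieSubmodule.coe_sub, LieSubmodule.coe_zero, hbr, hω,
        lie_sub]
      rw [← lie_skew (σ z) (σ x), lie_neg] at h1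
      rw [← lie_skew z x, lie_neg, ← lie_skew x ⁅y, z⁆, ← lie_skew y ⁅x, z⁆,
        ← lie_skew z ⁅x, y⁆] at h2
      simp only [map_add, map_neg, neg_neg, map_zero] at h2
      rw [← lie_skew (σ ⁅x, y⁆), ← lie_skew (σ ⁅y, z⁆), ← lie_skew (σ ⁅x, z⁆)]
      refine Eq.trans ?_ ((congrArg₂ (· - ·) h1 h2).trans (sub_zero 0))
      abel))
  refine ⟨{ σ - f.ker.toSubmodule.subtype ∘ₗ φ with map_lie' := fun {x y} => ?_ }, fun x => ?_⟩
  · change σ ⁅x, y⁆ - (φ ⁅x, y⁆ : L) = ⁅σ x - (φ x : L), σ y - (φ y : L)⁆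
    have h := congrArg Subtype.val (hφ x y)
    simp only [LieSubmodule.coe_sub, hω, hbr] at h
    rw [sub_lie, lie_sub, lie_sub, hab _ (φ x).2 _ (φ y).2, ← lie_skew (φ x : L)]
    rw [← sub_eq_zero]
    refine Eq.trans ?_ (sub_eq_zero.2 h.symm)
    abel
  · change f (σ x - (φ x : L)) = x
    rw [map_sub, hσ, LieHom.mem_ker.1 (φ x).2, sub_zero]

/-- A surjection with solvable kernel onto a Killing Lie algebra splits. -/
theorem LieHom.exists_section_of_isSolvable_ker {L : Type*} [LieRing L] [LieAlgebra F L]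
    [FiniteDimensional F L] (f : L →ₗ⁅F⁆ S) (hf : Function.Surjective f) [IsSolvable f.ker] :
    ∃ s : S →ₗ⁅F⁆ L, ∀ x, f (s x) = x := by
  induction h : finrank F L using Nat.strong_induction_on generalizing L with
  | _ n ih =>
  subst h
  by_cases hbot : f.ker = ⊥
  · have hinj : Function.Injective f := f.ker_eq_bot.1 hbot
    let e := LieEquiv.ofBijective f ⟨hinj, hf⟩
    exact ⟨e.symm.toLieHom, fun x => e.apply_symm_apply x⟩
  by_cases hmin : IsAtom f.ker
  · refine f.exists_section_of_isAtom_ker hf ?_ hmin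
    have h1 : ⁅f.ker, f.ker⁆ ≤ f.ker := LieSubmodule.lie_le_right _ _
    rcases hmin.le_iff.1 h1 with h | h
    · exact (LieSubmodule.lie_eq_bot_iff _ _).1 h
    · exact absurd (f.ker.eq_bot_of_lie_self_eq h) hbot
  obtain ⟨W, hWK, hW⟩ : ∃ W : LieIdeal F L, W < f.ker ∧ W ≠ ⊥ := by
    by_contra! h
    exact hmin ⟨hbot, h⟩
  let f₁ := W.quotientLift f hWK.le
  have hf₁ : Function.Surjective f₁ := fun y => by
    obtain ⟨x, rfl⟩ := hf y
    exact ⟨W.quotientHom x, rfl⟩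
  have : IsSolvable f₁.ker := by
    let g : f.ker →ₗ⁅F⁆ f₁.ker :=
      { toFun := fun x => ⟨W.quotientHom x, LieHom.mem_ker.2 (LieHom.mem_ker.1 x.2)⟩
        map_add' := fun _ _ => rfl
        map_smul' := fun _ _ => rfl
        map_lie' := rfl }
    refine Function.Surjective.lieAlgebra_isSolvable (f := g) ?_
    rintro ⟨y, hy⟩
    obtain ⟨x, rfl⟩ := W.quotientHom_surjective y
    exact ⟨⟨x, LieHom.mem_ker.2 (LieHom.mem_ker.1 hy)⟩, rfl⟩
  have hlt : finrank F (L ⧸ W) < finrank F L := by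
    have h1 := Submodule.finrank_quotient_add_finrank W.toSubmodule
    have h2 : finrank F W.toSubmodule ≠ 0 := by
      rw [Ne, Submodule.finrank_eq_zero, LieSubmodule.toSubmodule_eq_bot]
      exact hW
    change finrank F (L ⧸ W.toSubmodule) < _
    omega
  obtain ⟨s₁, hs₁⟩ := ih _ hlt f₁ hf₁ rfl
  let C : LieSubalgebra F L := s₁.range.comap W.quotientHom
  have hC {x : L} : x ∈ C ↔ s₁ (f x) = W.quotientHom x := by
    constructor
    · rintro ⟨t, ht⟩
      have h1 : t = f x := by
        rw [← hs₁ t]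
        exact congrArg f₁ ht
      rw [← h1]
      exact ht
    · exact fun h => ⟨f x, h⟩
  let f₂ : C →ₗ⁅F⁆ S := f.comp C.incl
  have hf₂ : Function.Surjective f₂ := fun y => by
    obtain ⟨x, hx⟩ := W.quotientHom_surjective (s₁ y)
    have hxy : f x = y := by
      rw [← hs₁ y, ← hx]
      rfl
    exact ⟨⟨x, hC.2 (by rw [hxy, hx])⟩, hxy⟩
  have : IsSolvable f₂.ker := by
    let g : f₂.ker →ₗ⁅F⁆ f.ker :=
      { toFun := fun x => ⟨x.1.1, LieHom.mem_ker.2 (LieHom.mem_ker.1 x.2)⟩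
        map_add' := fun _ _ => rfl
        map_smul' := fun _ _ => rfl
        map_lie' := rfl }
    exact Function.Injective.lieAlgebra_isSolvable (f := g)
      fun x y hxy => Subtype.ext (Subtype.ext (congrArg (Subtype.val : f.ker → L) hxy))
  have hlt₂ : finrank F C < finrank F L := by
    refine Submodule.finrank_lt (s := C.toSubmodule) fun h => hWK.not_ge fun x hx => ?_
    have h1 : x ∈ C := by
      have : x ∈ C.toSubmodule := by rw [h]; trivial
      exact this
    rw [hC, LieHom.mem_ker.1 hx, map_zero] at h1
    exact LieIdeal.quotientHom_eq_zero.1 h1.symm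
  obtain ⟨s₂, hs₂⟩ := ih _ hlt₂ f₂ hf₂ rfl
  exact ⟨C.incl.comp s₂, hs₂⟩

end Splitting

section Radical

open LieAlgebra

variable {F L : Type*} [Field F] [LieRing L] [LieAlgebra F L] [FiniteDimensional F L]

theorem LieAlgebra.radical_quotient_radical : radical F (L ⧸ radical F L) = ⊥ := by
  rw [eq_bot_iff]
  intro y hy
  obtain ⟨x, rfl⟩ := (radical F L).quotientHom_surjective y
  have : IsSolvable (radical F L).quotientHom.ker := by
    rw [LieIdeal.ker_quotientHom]
    infer_instance
  have h := (LieIdeal.solvable_iff_le_radical F L _).1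
    (LieIdeal.isSolvable_comap_s12 (radical F L).quotientHom (radical F (L ⧸ radical F L)))
  rw [LieSubmodule.mem_bot, LieIdeal.quotientHom_eq_zero]
  exact h (LieIdeal.mem_comap.2 hy)

theorem LieHom.map_mem_radical {L' : Type*} [LieRing L'] [LieAlgebra F L']
    [FiniteDimensional F L'] (f : L →ₗ⁅F⁆ L') (hf : Function.Surjective f) {x : L}
    (hx : x ∈ radical F L) : f x ∈ radical F L' := by
  let J := (radical F L).map f
  let g : radical F L →ₗ⁅F⁆ J :=
    { toFun := fun x => ⟨f x, LieIdeal.mem_map x.2⟩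
      map_add' := fun x y => Subtype.ext (map_add f (x : L) y)
      map_smul' := fun t x => Subtype.ext (map_smul f t (x : L))
      map_lie' := fun {x y} => Subtype.ext (f.map_lie (x : L) y) }
  have : IsSolvable J := by
    refine Function.Surjective.lieAlgebra_isSolvable (f := g) ?_
    rintro ⟨y, hy⟩
    obtain ⟨z, hz⟩ := LieIdeal.mem_map_of_surjective hf hy
    exact ⟨z, Subtype.ext hz⟩
  exact (LieIdeal.solvable_iff_le_radical F L' J).1 this (LieIdeal.mem_map hx)

/-- A subalgebra which together with the radical spans the algebra has its radical inside
the radical of the algebra. -/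
theorem LieSubalgebra.coe_mem_radical (C : LieSubalgebra F L)
    (hC : C.toSubmodule ⊔ (radical F L).toSubmodule = ⊤) {x : C} (hx : x ∈ radical F C) :
    (x : L) ∈ radical F L := by
  let f : C →ₗ⁅F⁆ L ⧸ radical F L := (radical F L).quotientHom.comp C.incl
  have hf : Function.Surjective f := fun y => by
    obtain ⟨z, rfl⟩ := (radical F L).quotientHom_surjective y
    have hz : z ∈ C.toSubmodule ⊔ (radical F L).toSubmodule := by rw [hC]; trivial
    obtain ⟨c, hc, r, hr, rfl⟩ := Submodule.mem_sup.1 hz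
    refine ⟨⟨c, hc⟩, ?_⟩
    rw [map_add, LieIdeal.quotientHom_eq_zero.2 hr, add_zero]
    rfl
  have h := f.map_mem_radical hf hx
  rw [radical_quotient_radical, LieSubmodule.mem_bot] at h
  exact LieIdeal.quotientHom_eq_zero.1 h

theorem LieSubalgebra.mem_radical_of_coe_mem (C : LieSubalgebra F L) {x : C}
    (hx : (x : L) ∈ radical F L) : x ∈ radical F C := by
  let f : (radical F L).comap C.incl →ₗ⁅F⁆ radical F L :=
    { toFun := fun x => ⟨x.1.1, LieIdeal.mem_comap.1 x.2⟩
      map_add' := fun _ _ => rfl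
      map_smul' := fun _ _ => rfl
      map_lie' := rfl }
  have : IsSolvable ((radical F L).comap C.incl) :=
    Function.Injective.lieAlgebra_isSolvable (f := f)
      fun x y hxy => Subtype.ext (Subtype.ext (congrArg (Subtype.val : radical F L → L) hxy))
  exact (LieIdeal.solvable_iff_le_radical F C _).1 this (LieIdeal.mem_comap.2 hx)

end Radical

section Projection

open DirectSum

variable {F G M : Type*} [Field F] [DecidableEq G] [AddCommGroup M] [Module F M]
  (𝒜 : G → Submodule F M) [Decomposition 𝒜]

/-- The projection onto a homogeneous component, as an endomorphism. -/
def DirectSum.Decomposition.projection (g : G) : M →ₗ[F] M :=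
  (𝒜 g).subtype ∘ₗ component F G (fun i => 𝒜 i) g ∘ₗ (decomposeLinearEquiv 𝒜).toLinearMap

theorem DirectSum.Decomposition.projection_mem (g : G) (x : M) : projection 𝒜 g x ∈ 𝒜 g :=
  (decompose 𝒜 x g).2

theorem DirectSum.Decomposition.projection_of_mem {g : G} {x : M} (hx : x ∈ 𝒜 g) :
    projection 𝒜 g x = x := decompose_of_mem_same 𝒜 hx

theorem DirectSum.Decomposition.projection_of_mem_ne {g h : G} {x : M} (hx : x ∈ 𝒜 g)
    (hgh : g ≠ h) : projection 𝒜 h x = 0 := decompose_of_mem_ne 𝒜 hx hgh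

theorem DirectSum.Decomposition.mem_of_projection_mem {P : Submodule F M} {x : M}
    (h : ∀ g, projection 𝒜 g x ∈ P) : x ∈ P := by
  classical
  rw [← sum_support_decompose 𝒜 x]
  exact P.sum_mem fun g _ => h g

/-- To check a property closed under addition, it suffices to check it on the homogeneous
components. -/
theorem DirectSum.Decomposition.mem_of_forall_mem {P : Submodule F M}
    (h : ∀ g, ∀ x ∈ 𝒜 g, x ∈ P) (x : M) : x ∈ P :=
  mem_of_projection_mem 𝒜 fun g => h g _ (projection_mem 𝒜 g x)

/-- The degree preserving part of a linear endomorphism. -/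
def DirectSum.Decomposition.diagonal (p : M →ₗ[F] M) : M →ₗ[F] M :=
  toModule F G M (fun g => projection 𝒜 g ∘ₗ p ∘ₗ (𝒜 g).subtype) ∘ₗ
    (decomposeLinearEquiv 𝒜).toLinearMap

theorem DirectSum.Decomposition.diagonal_of_mem (p : M →ₗ[F] M) {g : G} {x : M} (hx : x ∈ 𝒜 g) :
    diagonal 𝒜 p x = projection 𝒜 g (p x) := by
  lift x to 𝒜 g using hx
  simp only [diagonal, LinearMap.comp_apply, LinearEquiv.coe_coe,
    decomposeLinearEquiv_apply_coe, toModule_lof, Submodule.subtype_apply]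

theorem DirectSum.Decomposition.diagonal_mem (p : M →ₗ[F] M) {g : G} {x : M} (hx : x ∈ 𝒜 g) :
    diagonal 𝒜 p x ∈ 𝒜 g := by
  rw [diagonal_of_mem 𝒜 p hx]
  exact projection_mem 𝒜 g _

theorem DirectSum.Decomposition.projection_comm_of_mem {f : M →ₗ[F] M}
    (hf : ∀ g, ∀ x ∈ 𝒜 g, f x ∈ 𝒜 g) (g : G) (x : M) :
    projection 𝒜 g (f x) = f (projection 𝒜 g x) := by
  rw [← sub_eq_zero]
  refine mem_of_forall_mem 𝒜
    (P := LinearMap.ker (projection 𝒜 g ∘ₗ f - f ∘ₗ projection 𝒜 g)) (fun h x hx => ?_) x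
  change projection 𝒜 g (f x) - f (projection 𝒜 g x) = 0
  rcases eq_or_ne h g with rfl | hg
  · rw [projection_of_mem 𝒜 hx, projection_of_mem 𝒜 (hf _ _ hx), sub_self]
  · rw [projection_of_mem_ne 𝒜 hx hg, projection_of_mem_ne 𝒜 (hf _ _ hx) hg, map_zero, sub_zero]

end Projection

section Graded

open LieAlgebra DirectSum DirectSum.Decomposition

variable {F G L : Type*} [Field F] [Group G] [DecidableEq G] [LieRing L] [LieAlgebra F L]
  {𝒜 : G → Submodule F L} [Decomposition 𝒜]

theorem LieAlgebra.projection_lie_right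
    (hbr : ∀ g h : G, ∀ x ∈ 𝒜 g, ∀ y ∈ 𝒜 h, ⁅x, y⁆ ∈ 𝒜 (g * h))
    {g : G} {x : L} (hx : x ∈ 𝒜 g) (h : G) (y : L) :
    projection 𝒜 (g * h) ⁅x, y⁆ = ⁅x, projection 𝒜 h y⁆ := by
  rw [← sub_eq_zero]
  refine mem_of_forall_mem 𝒜 (P := LinearMap.ker
    (projection 𝒜 (g * h) ∘ₗ (ad F L x : L →ₗ[F] L) - (ad F L x : L →ₗ[F] L) ∘ₗ projection 𝒜 h))
    (fun k y hy => ?_) y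
  change projection 𝒜 (g * h) ⁅x, y⁆ - ⁅x, projection 𝒜 h y⁆ = 0
  rcases eq_or_ne k h with rfl | hk
  · rw [projection_of_mem 𝒜 hy, projection_of_mem 𝒜 (hbr _ _ x hx y hy), sub_self]
  · rw [projection_of_mem_ne 𝒜 hy hk, projection_of_mem_ne 𝒜 (hbr _ _ x hx y hy)
      fun e => hk (mul_left_cancel e), lie_zero, sub_zero]

theorem LieAlgebra.projection_lie_left
    (hbr : ∀ g h : G, ∀ x ∈ 𝒜 g, ∀ y ∈ 𝒜 h, ⁅x, y⁆ ∈ 𝒜 (g * h))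
    (g : G) {h : G} (x : L) {y : L} (hy : y ∈ 𝒜 h) :
    projection 𝒜 (g * h) ⁅x, y⁆ = ⁅projection 𝒜 g x, y⁆ := by
  rw [← lie_skew x y, ← lie_skew _ y, map_neg, neg_inj, ← sub_eq_zero]
  refine mem_of_forall_mem 𝒜 (P := LinearMap.ker
    (projection 𝒜 (g * h) ∘ₗ (ad F L y : L →ₗ[F] L) - (ad F L y : L →ₗ[F] L) ∘ₗ projection 𝒜 g))
    (fun k x hx => ?_) x
  change projection 𝒜 (g * h) ⁅y, x⁆ - ⁅y, projection 𝒜 g x⁆ = 0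
  have hxy : ⁅y, x⁆ ∈ 𝒜 (k * h) := by
    rw [← lie_skew]
    exact neg_mem (hbr _ _ x hx y hy)
  rcases eq_or_ne k g with rfl | hk
  · rw [projection_of_mem 𝒜 hx, projection_of_mem 𝒜 hxy, sub_self]
  · rw [projection_of_mem_ne 𝒜 hx hk, projection_of_mem_ne 𝒜 hxy
      fun e => hk (mul_right_cancel e), lie_zero, sub_zero]

/-- The commutator of a graded ideal with itself is graded. -/
theorem LieIdeal.projection_mem_lie
    (hbr : ∀ g h : G, ∀ x ∈ 𝒜 g, ∀ y ∈ 𝒜 h, ⁅x, y⁆ ∈ 𝒜 (g * h)) {I : LieIdeal F L}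
    (hI : ∀ g, ∀ x ∈ I, projection 𝒜 g x ∈ I) (g : G) {x : L} (hx : x ∈ ⁅I, I⁆) :
    projection 𝒜 g x ∈ ⁅I, I⁆ := by
  rw [← LieSubmodule.mem_toSubmodule, LieSubmodule.lieIdeal_oper_eq_linear_span'] at hx
  induction hx using Submodule.span_induction with
  | zero => rw [map_zero]; exact zero_mem _
  | add x y _ _ hx hy => rw [map_add]; exact add_mem hx hy
  | smul t x _ hx => rw [map_smul]; exact Submodule.smul_mem _ t hx
  | mem x hx =>
    obtain ⟨a, ha, b, hb, rfl⟩ := hx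
    refine mem_of_projection_mem 𝒜 (P := (⁅I, I⁆ : LieIdeal F L).toSubmodule.comap
      (projection 𝒜 g ∘ₗ (ad F L a : L →ₗ[F] L))) (x := b) fun h => ?_
    change projection 𝒜 g ⁅a, projection 𝒜 h b⁆ ∈ ⁅I, I⁆
    have h1 := projection_lie_left hbr (g * h⁻¹) a (projection_mem 𝒜 h b)
    rw [inv_mul_cancel_right] at h1
    rw [h1]
    exact LieSubmodule.lie_mem_lie (hI _ a ha) (hI _ b hb)

theorem LieAlgebra.killingForm_quotient_eq_zero [FiniteDimensional F L]
    (hbr : ∀ g h : G, ∀ x ∈ 𝒜 g, ∀ y ∈ 𝒜 h, ⁅x, y⁆ ∈ 𝒜 (g * h)) {I : LieIdeal F L}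
    (hI : ∀ g, ∀ x ∈ I, projection 𝒜 g x ∈ I) {g h : G} (hgh : g * h ≠ 1) {x y : L}
    (hx : x ∈ 𝒜 g) (hy : y ∈ 𝒜 h) :
    killingForm F (L ⧸ I) (I.quotientHom x) (I.quotientHom y) = 0 := by
  let q : L →ₗ[F] L ⧸ I := I.quotientHom
  obtain ⟨σ, hσ⟩ := q.exists_rightInverse_of_surjective
    (LinearMap.range_eq_top.2 I.quotientHom_surjective)
  replace hσ (z : L ⧸ I) : q (σ z) = z := LinearMap.congr_fun hσ z
  have hq {z : L} : q z = 0 ↔ z ∈ I := LieIdeal.quotientHom_eq_zero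
  let e := diagonal 𝒜 (σ ∘ₗ q)
  have he (z : L) : q (e z) = q z := by
    rw [← sub_eq_zero, ← map_sub, hq]
    refine mem_of_forall_mem 𝒜 (P := I.toSubmodule.comap (e - LinearMap.id)) (fun k z hz => ?_) z
    change e z - z ∈ I
    have h1 : σ (q z) - z ∈ I := by rw [← hq, map_sub, hσ, sub_self]
    have h2 := hI k _ h1
    have h3 : e z = projection 𝒜 k (σ (q z)) := diagonal_of_mem 𝒜 _ hz
    rwa [map_sub, projection_of_mem 𝒜 hz, ← h3] at h2
  have heI : I.toSubmodule ≤ LinearMap.ker e := fun z hz => by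
    refine mem_of_projection_mem 𝒜 (P := LinearMap.ker e) fun k => ?_
    rw [LinearMap.mem_ker, diagonal_of_mem 𝒜 _ (projection_mem 𝒜 k z), LinearMap.comp_apply,
      hq.2 (hI k z hz), map_zero, map_zero]
  let e' : L ⧸ I →ₗ[F] L := I.toSubmodule.liftQ e heI
  let φ : L →ₗ[F] L := (ad F L x : L →ₗ[F] L) ∘ₗ (ad F L y : L →ₗ[F] L)
  have h1 : killingForm F (L ⧸ I) (I.quotientHom x) (I.quotientHom y) =
      LinearMap.trace F (L ⧸ I) (q ∘ₗ (φ ∘ₗ e')) := by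
    rw [LieModule.traceForm_apply_apply]
    congr 1
    ext z
    obtain ⟨z, rfl⟩ := I.quotientHom_surjective z
    change ⁅q x, ⁅q y, q z⁆⁆ = q ⁅x, ⁅y, e z⁆⁆
    rw [← he z]
    rfl
  have h2 : (φ ∘ₗ e') ∘ₗ q = φ ∘ₗ e := rfl
  rw [h1, LinearMap.trace_comp_comm', h2]
  refine LinearMap.trace_eq_zero_of_mapsTo_ne (Decomposition.isInternal 𝒜) (fun k => g * (h * k))
    (fun k hk => hgh ?_) fun k z hz => hbr g _ x hx _ (hbr h k y hy _ (diagonal_mem 𝒜 _ hz))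
  rwa [← mul_assoc, mul_eq_right] at hk

/-- The radical of a graded Lie algebra in characteristic zero is graded. -/
theorem LieAlgebra.projection_mem_radical [CharZero F] [FiniteDimensional F L]
    (hbr : ∀ g h : G, ∀ x ∈ 𝒜 g, ∀ y ∈ 𝒜 h, ⁅x, y⁆ ∈ 𝒜 (g * h)) (g : G) {x : L}
    (hx : x ∈ radical F L) : projection 𝒜 g x ∈ radical F L := by
  obtain ⟨I, ⟨hIs, hIg⟩, hmax⟩ := exists_maximal_of_wellFoundedGT
    (fun I : LieIdeal F L => IsSolvable I ∧ ∀ g, ∀ x ∈ I, projection 𝒜 g x ∈ I)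
    ⟨⊥, inferInstance, fun g x hx => by
      rw [LieSubmodule.mem_bot] at hx ⊢
      rw [hx, map_zero]⟩
  let J' := LieIdeal.killingCompl F (L ⧸ I) ⊤
  have hJ' {y : L ⧸ I} : y ∈ J' ↔ ∀ z, killingForm F (L ⧸ I) y z = 0 := by
    rw [LieIdeal.mem_killingCompl]
    refine ⟨fun h z => ?_, fun h z _ => ?_⟩
    · rw [LieModule.traceForm_comm, h z trivial]
    · rw [LieModule.traceForm_comm, h z]
  have : IsSolvable J' :=
    LieIdeal.isSolvable_of_killingForm_apply_lie_eq_zero J' fun y hy z _ => hJ'.1 hy z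
  let J := J'.comap I.quotientHom
  have : IsSolvable I.quotientHom.ker := by rwa [LieIdeal.ker_quotientHom]
  have hJ {y : L} : y ∈ J ↔ ∀ z, killingForm F (L ⧸ I) (I.quotientHom y) (I.quotientHom z) = 0 := by
    rw [LieIdeal.mem_comap, hJ']
    refine ⟨fun h z => h _, fun h z => ?_⟩
    obtain ⟨z, rfl⟩ := I.quotientHom_surjective z
    exact h z
  have hJI : J ≤ I := by
    refine hmax ⟨LieIdeal.isSolvable_comap_s12 _ J', fun g y hy => hJ.2 fun z => ?_⟩ fun y hy => ?_
    · refine mem_of_forall_mem 𝒜 (P := LinearMap.ker ((killingForm F (L ⧸ I)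
        (I.quotientHom (projection 𝒜 g y))) ∘ₗ (I.quotientHom : L →ₗ[F] L ⧸ I)))
          (fun h z hz => ?_) z
      change killingForm F (L ⧸ I) (I.quotientHom (projection 𝒜 g y)) (I.quotientHom z) = 0
      by_cases hgh : g * h = 1
      · rw [← hJ.1 hy z, ← sub_eq_zero, ← LinearMap.sub_apply, ← map_sub, ← map_sub]
        refine mem_of_forall_mem 𝒜 (P := LinearMap.ker (((killingForm F (L ⧸ I)).flip
          (I.quotientHom z)) ∘ₗ (I.quotientHom : L →ₗ[F] L ⧸ I) ∘ₗ (projection 𝒜 g - LinearMap.id)))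
          (fun k y hy => ?_) y
        change killingForm F (L ⧸ I) (I.quotientHom (projection 𝒜 g y - y)) (I.quotientHom z) = 0
        rcases eq_or_ne k g with rfl | hk
        · rw [projection_of_mem 𝒜 hy, sub_self, map_zero, map_zero, LinearMap.zero_apply]
        · rw [projection_of_mem_ne 𝒜 hy hk, zero_sub, map_neg, map_neg, LinearMap.neg_apply,
            killingForm_quotient_eq_zero hbr hIg _ hy hz, neg_zero]
          exact fun h1 => hk (mul_right_cancel (h1.trans hgh.symm))
      · exact killingForm_quotient_eq_zero hbr hIg hgh (projection_mem 𝒜 g y) hz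
    · refine hJ.2 fun z => ?_
      rw [LieIdeal.quotientHom_eq_zero.2 hy, map_zero, LinearMap.zero_apply]
  have hbot : J' = ⊥ := by
    refine (LieSubmodule.eq_bot_iff _).2 fun y hy => ?_
    obtain ⟨y, rfl⟩ := I.quotientHom_surjective y
    exact LieIdeal.quotientHom_eq_zero.2 (hJI (LieIdeal.mem_comap.2 hy))
  have : IsKilling F (L ⧸ I) := ⟨hbot⟩
  have hRI : radical F L ≤ I := fun y hy => by
    have h := I.quotientHom.map_mem_radical I.quotientHom_surjective hy
    rw [HasTrivialRadical.radical_eq_bot, LieSubmodule.mem_bot] at h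
    exact LieIdeal.quotientHom_eq_zero.1 h
  exact (LieIdeal.solvable_iff_le_radical F L I).1 hIs (hIg g x (hRI hx))

end Graded

section Levi

open LieAlgebra DirectSum DirectSum.Decomposition Module

variable {F G : Type*} [Field F] [CharZero F] [Group G] [DecidableEq G]

/-- A graded Lie algebra with nonzero radical contains a proper graded subalgebra which together
with the radical spans the algebra and meets the radical only in its commutator. -/
theorem LieAlgebra.exists_graded_subalgebra {L : Type*} [LieRing L] [LieAlgebra F L]
    [FiniteDimensional F L] {𝒜 : G → Submodule F L} [Decomposition 𝒜]
    (hbr : ∀ g h : G, ∀ x ∈ 𝒜 g, ∀ y ∈ 𝒜 h, ⁅x, y⁆ ∈ 𝒜 (g * h)) :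
    ∃ C : LieSubalgebra F L, (∀ g, ∀ x ∈ C, projection 𝒜 g x ∈ C) ∧
      C.toSubmodule ⊔ (radical F L).toSubmodule = ⊤ ∧
      ∀ x ∈ C, x ∈ radical F L → x ∈ ⁅radical F L, radical F L⁆ := by
  set R := radical F L with hR
  have hRg : ∀ g, ∀ x ∈ R, projection 𝒜 g x ∈ R := fun g x hx => projection_mem_radical hbr g hx
  have : HasTrivialRadical F (L ⧸ R) := ⟨radical_quotient_radical⟩
  have : IsSolvable R.quotientHom.ker := by
    rw [LieIdeal.ker_quotientHom]
    exact radicalIsSolvable F L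
  obtain ⟨s, hs⟩ := R.quotientHom.exists_section_of_isSolvable_ker R.quotientHom_surjective
  have hq {x : L} : R.quotientHom x = 0 ↔ x ∈ R := LieIdeal.quotientHom_eq_zero
  let p : L →ₗ[F] L := LinearMap.id - (s : L ⧸ R →ₗ[F] L) ∘ₗ (R.quotientHom : L →ₗ[F] L ⧸ R)
  have hp (x : L) : p x = x - s (R.quotientHom x) := rfl
  have hpR (x : L) : p x ∈ R := by rw [← hq, hp, map_sub, hs, sub_self]
  have hpid {x : L} (hx : x ∈ R) : p x = x := by rw [hp, hq.2 hx, map_zero, sub_zero]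
  have hpder (x y : L) : p ⁅x, y⁆ - ⁅p x, y⁆ - ⁅x, p y⁆ ∈ ⁅R, R⁆ := by
    have h : p ⁅x, y⁆ - ⁅p x, y⁆ - ⁅x, p y⁆ = -⁅p x, p y⁆ := by
      simp only [hp, LieHom.map_lie, sub_lie, lie_sub]
      abel
    rw [h]
    exact neg_mem (LieSubmodule.lie_mem_lie (hpR x) (hpR y))
  let p₀ := diagonal 𝒜 p
  have hp₀ {g : G} {x : L} (hx : x ∈ 𝒜 g) : p₀ x = projection 𝒜 g (p x) := diagonal_of_mem 𝒜 p hx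
  have hp₀R (x : L) : p₀ x ∈ R := by
    refine mem_of_forall_mem 𝒜 (P := R.toSubmodule.comap p₀) (fun g x hx => ?_) x
    change p₀ x ∈ R
    rw [hp₀ hx]
    exact hRg g _ (hpR x)
  have hp₀id {x : L} (hx : x ∈ R) : p₀ x = x := by
    rw [← sub_eq_zero]
    refine mem_of_projection_mem 𝒜 (P := LinearMap.ker (p₀ - LinearMap.id)) fun g => ?_
    have hm := projection_mem 𝒜 g x
    change p₀ (projection 𝒜 g x) - projection 𝒜 g x = 0
    rw [hp₀ hm, hpid (hRg g x hx), projection_of_mem 𝒜 hm, sub_self]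
  have hp₀der (x y : L) : p₀ ⁅x, y⁆ - ⁅p₀ x, y⁆ - ⁅x, p₀ y⁆ ∈ ⁅R, R⁆ := by
    let ψ (f : L →ₗ[F] L) : L →ₗ[F] L →ₗ[F] L := LinearMap.mk₂ F
      (fun x y => f ⁅x, y⁆ - ⁅f x, y⁆ - ⁅x, f y⁆)
      (fun x y z => by simp only [map_add, add_lie]; abel)
      (fun t x y => by simp only [map_smul, smul_lie, smul_sub])
      (fun x y z => by simp only [map_add, lie_add]; abel)
      (fun t x y => by simp only [map_smul, lie_smul, smul_sub])
    refine mem_of_forall_mem 𝒜 (P := (⁅R, R⁆ : LieIdeal F L).toSubmodule.comap ((ψ p₀).flip y))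
      (fun g x hx => ?_) x
    refine mem_of_forall_mem 𝒜 (P := (⁅R, R⁆ : LieIdeal F L).toSubmodule.comap (ψ p₀ x))
      (fun h y hy => ?_) y
    change p₀ ⁅x, y⁆ - ⁅p₀ x, y⁆ - ⁅x, p₀ y⁆ ∈ ⁅R, R⁆
    rw [hp₀ (hbr g h x hx y hy), hp₀ hx, hp₀ hy, ← projection_lie_left hbr g _ hy,
      ← projection_lie_right hbr hx, ← map_sub, ← map_sub]
    exact LieIdeal.projection_mem_lie hbr hRg _ (hpder x y)
  let C : LieSubalgebra F L :=
    { (⁅R, R⁆ : LieIdeal F L).toSubmodule.comap p₀ with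
      lie_mem' := fun {x y} hx hy => by
        replace hx : p₀ x ∈ ⁅R, R⁆ := hx
        replace hy : p₀ y ∈ ⁅R, R⁆ := hy
        change p₀ ⁅x, y⁆ ∈ ⁅R, R⁆
        have h := add_mem (add_mem (hp₀der x y) (lie_mem_right F L _ x _ hy))
          (lie_mem_left F L _ _ y hx)
        rwa [sub_add_cancel, sub_add_cancel] at h }
  have hC {x : L} : x ∈ C ↔ p₀ x ∈ ⁅R, R⁆ := Iff.rfl
  refine ⟨C, fun g x hx => ?_, eq_top_iff.2 fun x _ => ?_, fun x hx hxR => ?_⟩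
  · rw [hC] at hx ⊢
    rw [← projection_comm_of_mem 𝒜 (fun g x hx => diagonal_mem 𝒜 p hx)]
    exact LieIdeal.projection_mem_lie hbr hRg g hx
  · refine Submodule.mem_sup.2 ⟨x - p₀ x, ?_, p₀ x, hp₀R x, sub_add_cancel _ _⟩
    refine hC.2 ?_
    rw [map_sub, hp₀id (hp₀R x), sub_self]
    exact zero_mem _
  · rwa [hC, hp₀id hxR] at hx

/-- A graded complement of the radical, as a subalgebra. -/
theorem LieAlgebra.exists_graded_isCompl_radical {L : Type*} [LieRing L] [LieAlgebra F L]
    [FiniteDimensional F L] (𝒜 : G → Submodule F L)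
    (hbr : ∀ g h : G, ∀ x ∈ 𝒜 g, ∀ y ∈ 𝒜 h, ⁅x, y⁆ ∈ 𝒜 (g * h)) (h𝒜 : IsInternal 𝒜) :
    ∃ B : LieSubalgebra F L, B.toSubmodule ≤ (⨆ g : G, B.toSubmodule ⊓ 𝒜 g) ∧
      IsCompl B.toSubmodule (radical F L).toSubmodule := by
  induction h : finrank F L using Nat.strong_induction_on generalizing L with
  | _ n ih =>
  subst h
  by_cases hR : radical F L = ⊥
  · refine ⟨⊤, ?_, ?_⟩
    · simp [h𝒜.submodule_iSup_eq_top]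
    · rw [hR]
      exact isCompl_top_bot
  let _ := h𝒜.chooseDecomposition
  obtain ⟨C, hCg, hCR, hCW⟩ := exists_graded_subalgebra hbr
  let 𝒞 (g : G) : Submodule F C := (𝒜 g).comap C.toSubmodule.subtype
  have h𝒞 : IsInternal 𝒞 := by
    rw [isInternal_submodule_iff_iSupIndep_and_iSup_eq_top]
    refine ⟨fun g => ?_, eq_top_iff.2 fun x _ => ?_⟩
    · rw [Submodule.disjoint_def]
      intro x hx hx'
      have h1 := Submodule.mem_map_of_mem (f := C.toSubmodule.subtype) hx'
      simp only [Submodule.map_iSup] at h1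
      refine Subtype.ext (Submodule.disjoint_def.1 (h𝒜.submodule_iSupIndep g) _ hx ?_)
      exact iSup₂_mono (fun j _ => Submodule.map_comap_le _ _) h1
    · classical
      have h1 : x = ∑ g ∈ (decompose 𝒜 (x : L)).support,
          (⟨projection 𝒜 g x, hCg g _ x.2⟩ : C) := by
        refine Subtype.ext ?_
        rw [AddSubmonoidClass.coe_finsetSum]
        exact (sum_support_decompose 𝒜 (x : L)).symm
      rw [h1]
      exact Submodule.sum_mem _ fun g _ => Submodule.mem_iSup_of_mem g (projection_mem 𝒜 g (x : L))
  have hlt : finrank F C < finrank F L := by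
    refine Submodule.finrank_lt (s := C.toSubmodule) fun h => hR ?_
    refine (radical F L).eq_bot_of_lie_self_eq (le_antisymm (LieSubmodule.lie_le_right _ _) ?_)
    intro x hx
    have : x ∈ C.toSubmodule := by rw [h]; trivial
    exact hCW x this hx
  obtain ⟨B, hBg, hB⟩ := ih _ hlt 𝒞 (fun g h x hx y hy => hbr g h x hx y hy) h𝒞 rfl
  refine ⟨B.map C.incl, ?_, ?_⟩
  · have h1 := Submodule.map_mono (f := C.toSubmodule.subtype) hBg
    rw [Submodule.map_iSup] at h1
    refine h1.trans (iSup_mono fun g => le_inf ?_ ?_)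
    · exact Submodule.map_mono inf_le_left
    · exact (Submodule.map_mono inf_le_right).trans (Submodule.map_comap_le _ _)
  · refine ⟨Submodule.disjoint_def.2 ?_, codisjoint_iff.2 (eq_top_iff.2 fun x _ => ?_)⟩
    · rintro _ ⟨x, hx, rfl⟩ hxR
      have h1 : x = 0 := Submodule.disjoint_def.1 hB.disjoint x hx (C.mem_radical_of_coe_mem hxR)
      rw [h1]
      rfl
    · have hx : x ∈ C.toSubmodule ⊔ (radical F L).toSubmodule := by rw [hCR]; trivial
      obtain ⟨c, hc, r, hr, rfl⟩ := Submodule.mem_sup.1 hx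
      have hc' : (⟨c, hc⟩ : C) ∈ B.toSubmodule ⊔ (radical F C).toSubmodule := by
        rw [hB.sup_eq_top]; trivial
      obtain ⟨b, hb, t, ht, hbt⟩ := Submodule.mem_sup.1 hc'
      refine Submodule.mem_sup.2 ⟨b, ⟨b, hb, rfl⟩, t + r,
        add_mem (C.coe_mem_radical hCR ht) hr, ?_⟩
      rw [← add_assoc]
      exact congrArg (· + r) (congrArg Subtype.val hbt)

end Levi

/-- graded Levi theorem: a finite-dimensional Lie algebra over a field of
characteristic `0`, graded by an arbitrary group `G`, admits a graded semisimple Levi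
subalgebra `B` with `L = B ⊕ R` as vector spaces, where `R` is the solvable radical. -/
theorem stmt12 {F : Type*} [Field F] [CharZero F] {G : Type*} [Group G] [DecidableEq G]
    {L : Type*} [LieRing L] [LieAlgebra F L] [FiniteDimensional F L]
    (𝒜 : G → Submodule F L)
    (hbracket : ∀ g h : G, ∀ x ∈ 𝒜 g, ∀ y ∈ 𝒜 h, ⁅x, y⁆ ∈ 𝒜 (g * h))
    (hdecomp : DirectSum.IsInternal 𝒜) :
    ∃ B : LieSubalgebra F L,
      B.toSubmodule = (⨆ g : G, B.toSubmodule ⊓ 𝒜 g) ∧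
      LieAlgebra.radical F B = ⊥ ∧
      IsCompl B.toSubmodule (LieSubmodule.toSubmodule (LieAlgebra.radical F L)) := by
  obtain ⟨B, hBg, hB⟩ := LieAlgebra.exists_graded_isCompl_radical 𝒜 hbracket hdecomp
  refine ⟨B, le_antisymm hBg (iSup_le fun g => inf_le_left), ?_, hB⟩
  refine (LieSubmodule.eq_bot_iff _).2 fun x hx => Subtype.ext ?_
  exact Submodule.disjoint_def.1 hB.disjoint _ x.2 (B.coe_mem_radical hB.sup_eq_top hx)
end
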